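/- arXiv:2309.01011 — 7 statements merged into one kernel-verified Lean document; each statement's English description precedes it below -/
import Mathlib

section
/- The three q-difference operators Ô₁, Ô₃, Ô₅ pairwise commute as 𝐤-linear endomorphisms of K: Ô₁∘Ô₃ = Ô₃∘Ô₁, Ô₁∘Ô₅ = Ô₅∘Ô₁, and Ô₃∘Ô₅ = Ô₅∘Ô₃. -/
set_option synthInstance.maxHeartbeats 1000000
set_option maxHeartbeats 4000000

noncomputable section

/-- The ground field `𝐤 = ℂ(q^{1/4}, t^{1/4})`. -/
abbrev kk : Type := FractionRing (MvPolynomial (Fin 2) ℂ)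
/-- The field `K = 𝐤(X₁₂, X₂₃, X₁₃)`. -/
abbrev KK : Type := FractionRing (MvPolynomial (Fin 3) kk)

instance : Field kk := inferInstance
instance : Field KK := inferInstance
instance : Algebra kk KK := inferInstance

/-- `q^{1/4}`. -/
def q4 : kk := algebraMap (MvPolynomial (Fin 2) ℂ) kk (MvPolynomial.X 0)
/-- `t^{1/4}`. -/
def t4 : kk := algebraMap (MvPolynomial (Fin 2) ℂ) kk (MvPolynomial.X 1)

def X12 : KK := algebraMap (MvPolynomial (Fin 3) kk) KK (MvPolynomial.X 0)
def X23 : KK := algebraMap (MvPolynomial (Fin 3) kk) KK (MvPolynomial.X 1)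
def X13 : KK := algebraMap (MvPolynomial (Fin 3) kk) KK (MvPolynomial.X 2)

/-- `q^{1/2}` as an element of `K`. -/
def qh : KK := algebraMap kk KK (q4 ^ 2)
/-- `t^{1/2}` as an element of `K`. -/
def st : KK := algebraMap kk KK (t4 ^ 2)

/-- Multiplication operator. -/
def Mop (g : KK) : Module.End kk KK := LinearMap.mulLeft kk g

/-- An algebra automorphism as a `𝐤`-linear endomorphism. -/
def Eop (δ : KK ≃ₐ[kk] KK) : Module.End kk KK := δ.toLinearMap

/-- Coefficient of `Ô₁` at `(a, b)`. -/
def c1 (a b : ℤ) : KK :=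
  ((1 - st * X23 * X12 ^ a * X13 ^ b) * (1 - st * X23⁻¹ * X12 ^ a * X13 ^ b)) /
    (st * X12 ^ a * X13 ^ b * (X12 - X12⁻¹) * (X13 - X13⁻¹))

/-- Coefficient of `Ô₃` at `(a, b)`. -/
def c3 (a b : ℤ) : KK :=
  ((1 - st * X13 * X12 ^ a * X23 ^ b) * (1 - st * X13⁻¹ * X12 ^ a * X23 ^ b)) /
    (st * X12 ^ a * X23 ^ b * (X12 - X12⁻¹) * (X23 - X23⁻¹))

/-- Coefficient of `Ô₅` at `(a, b)`. -/
def c5 (a b : ℤ) : KK :=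
  ((1 - st * X12 * X13 ^ a * X23 ^ b) * (1 - st * X12⁻¹ * X13 ^ a * X23 ^ b)) /
    (st * X13 ^ a * X23 ^ b * (X13 - X13⁻¹) * (X23 - X23⁻¹))

/-- `Ô₁ = Σ_{a,b∈{±1}} a·b·M_{c1 a b} ∘ δ₁₂^a ∘ δ₁₃^b`. -/
def Ohat1 (δ12 δ13 : KK ≃ₐ[kk] KK) : Module.End kk KK :=
  Mop (c1 1 1) * Eop δ12 * Eop δ13
  - Mop (c1 1 (-1)) * Eop δ12 * Eop δ13.symm
  - Mop (c1 (-1) 1) * Eop δ12.symm * Eop δ13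
  + Mop (c1 (-1) (-1)) * Eop δ12.symm * Eop δ13.symm

/-- `Ô₃ = Σ_{a,b∈{±1}} a·b·M_{c3 a b} ∘ δ₁₂^a ∘ δ₂₃^b`. -/
def Ohat3 (δ12 δ23 : KK ≃ₐ[kk] KK) : Module.End kk KK :=
  Mop (c3 1 1) * Eop δ12 * Eop δ23
  - Mop (c3 1 (-1)) * Eop δ12 * Eop δ23.symm
  - Mop (c3 (-1) 1) * Eop δ12.symm * Eop δ23
  + Mop (c3 (-1) (-1)) * Eop δ12.symm * Eop δ23.symm

/-- `Ô₅ = Σ_{a,b∈{±1}} a·b·M_{c5 a b} ∘ δ₁₃^a ∘ δ₂₃^b`. -/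
def Ohat5 (δ13 δ23 : KK ≃ₐ[kk] KK) : Module.End kk KK :=
  Mop (c5 1 1) * Eop δ13 * Eop δ23
  - Mop (c5 1 (-1)) * Eop δ13 * Eop δ23.symm
  - Mop (c5 (-1) 1) * Eop δ13.symm * Eop δ23
  + Mop (c5 (-1) (-1)) * Eop δ13.symm * Eop δ23.symm

/-- The coefficient `(1 - s y x z)(1 - s y⁻¹ x z) / (s x z (x - x⁻¹)(z - z⁻¹))`. -/
def shiftCoeff {K : Type*} [Field K] (s x z y : K) : K :=
  ((1 - s * y * x * z) * (1 - s * y⁻¹ * x * z)) / (s * x * z * (x - x⁻¹) * (z - z⁻¹))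

/-- The difference operator with coefficients `shiftCoeff s x^{±1} z^{±1} y`, in which `α` shifts
`x` and `β` shifts `z`. -/
def shiftOp {k K : Type*} [Field k] [Field K] [Algebra k K] (s x z y : K) (α β : K ≃ₐ[k] K)
    (f : K) : K :=
  shiftCoeff s x z y * α (β f) + shiftCoeff s x z⁻¹ y * α (β.symm f)
    + shiftCoeff s x⁻¹ z y * α.symm (β f) + shiftCoeff s x⁻¹ z⁻¹ y * α.symm (β.symm f)

section Identities

variable {K : Type*} [Field K]

theorem shiftCoeff_comm (s x z y : K) : shiftCoeff s x z y = shiftCoeff s z x y := by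
  unfold shiftCoeff
  congr 1 <;> ring

theorem shiftCoeff_inv (s x z y : K) : shiftCoeff s x z y⁻¹ = shiftCoeff s x z y := by
  unfold shiftCoeff
  rw [inv_inv]
  ring

theorem sub_inv_ne_zero {x : K} (hx : x ≠ 0) (hx2 : x ^ 2 ≠ 1) : x - x⁻¹ ≠ 0 := by
  intro h
  apply hx2
  field_simp at h
  linear_combination h

theorem shiftCoeff_eq {s x z y : K} (hs : s ≠ 0) (hx : x ≠ 0) (hz : z ≠ 0) (hy : y ≠ 0)
    (hx2 : x ^ 2 ≠ 1) (hz2 : z ^ 2 ≠ 1) :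
    shiftCoeff s x z y =
      (1 - s * y * x * z) * (y - s * x * z) / (s * y * (x ^ 2 - 1) * (z ^ 2 - 1)) := by
  have h1 := sub_inv_ne_zero hx hx2
  have h2 := sub_inv_ne_zero hz hz2
  have h3 := sub_ne_zero.mpr hx2
  have h4 := sub_ne_zero.mpr hz2
  unfold shiftCoeff
  field_simp

theorem shiftCoeff_mul_same {s q x y z : K} (hs : s ≠ 0) (hq : q ≠ 0) (hx : x ≠ 0) (hy : y ≠ 0)
    (hz : z ≠ 0) (hx2 : x ^ 2 ≠ 1) (hy2 : y ^ 2 ≠ 1) (hz2 : z ^ 2 ≠ 1)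
    (hqx : (q * x) ^ 2 ≠ 1) :
    shiftCoeff s x z y * shiftCoeff s (q * x) y (q * z) =
      shiftCoeff s x y z * shiftCoeff s (q * x) z (q * y) := by
  rw [shiftCoeff_eq hs hx hz hy hx2 hz2, shiftCoeff_eq hs hx hy hz hx2 hy2,
    shiftCoeff_eq hs (mul_ne_zero hq hx) hy (mul_ne_zero hq hz) hqx hy2,
    shiftCoeff_eq hs (mul_ne_zero hq hx) hz (mul_ne_zero hq hy) hqx hz2]
  have h1 := sub_ne_zero.mpr hx2
  have h2 := sub_ne_zero.mpr hy2
  have h3 := sub_ne_zero.mpr hz2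
  have h4 := sub_ne_zero.mpr hqx
  field_simp

theorem shiftCoeff_mul_opposite {s q x y z : K} (hs : s ≠ 0) (hq : q ≠ 0) (hx : x ≠ 0)
    (hy : y ≠ 0) (hz : z ≠ 0) (hx2 : x ^ 2 ≠ 1) (hy2 : y ^ 2 ≠ 1) (hz2 : z ^ 2 ≠ 1)
    (hqx : (q * x) ^ 2 ≠ 1) (hqx' : x ^ 2 ≠ q ^ 2) :
    shiftCoeff s x z y * shiftCoeff s (q⁻¹ * x⁻¹) y (q * z)
        + shiftCoeff s x⁻¹ z y * shiftCoeff s (q⁻¹ * x) y (q * z) =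
      shiftCoeff s x y z * shiftCoeff s (q⁻¹ * x⁻¹) z (q * y)
        + shiftCoeff s x⁻¹ y z * shiftCoeff s (q⁻¹ * x) z (q * y) := by
  have h1 := sub_ne_zero.mpr hx2
  have h2 := sub_ne_zero.mpr hy2
  have h3 := sub_ne_zero.mpr hz2
  have h4 := sub_ne_zero.mpr hqx
  rw [mul_pow] at h4
  have h5 := sub_ne_zero.mpr hqx'
  have inv_sq_ne_one {w : K} (h : w ^ 2 ≠ 1) : w⁻¹ ^ 2 ≠ 1 := by simpa using h
  have hqx2 : (q⁻¹ * x) ^ 2 ≠ 1 := by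
    rwa [mul_pow, inv_pow, ne_eq, inv_mul_eq_one₀ (pow_ne_zero 2 hq), eq_comm]
  have inv_left {y z : K} (hy : y ≠ 0) (hz : z ≠ 0) (hz2 : z ^ 2 ≠ 1) :
      shiftCoeff s x⁻¹ z y =
        -((x - s * y * z) * (x * y - s * z) / (s * y * (x ^ 2 - 1) * (z ^ 2 - 1))) := by
    have h6 := sub_ne_zero.mpr hz2
    have h7 : 1 - x ^ 2 ≠ 0 := by rwa [← neg_sub, neg_ne_zero]
    rw [shiftCoeff_eq hs (inv_ne_zero hx) hz hy (inv_sq_ne_one hx2) hz2]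
    field_simp
    ring
  have shift_inv_left {y z : K} (hy : y ≠ 0) (hz : z ≠ 0) (hy2 : y ^ 2 ≠ 1) :
      shiftCoeff s (q⁻¹ * x⁻¹) y (q * z) =
        -((x - s * z * y) * (q ^ 2 * x * z - s * y) /
          (s * z * (q ^ 2 * x ^ 2 - 1) * (y ^ 2 - 1))) := by
    have h6 := sub_ne_zero.mpr hy2
    have h7 : 1 - q ^ 2 * x ^ 2 ≠ 0 := by rwa [← neg_sub, neg_ne_zero]
    rw [← mul_inv, shiftCoeff_eq hs (inv_ne_zero (mul_ne_zero hq hx)) hy (mul_ne_zero hq hz)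
      (inv_sq_ne_one hqx) hy2]
    field_simp
    ring
  have shift_left {y z : K} (hy : y ≠ 0) (hz : z ≠ 0) (hy2 : y ^ 2 ≠ 1) :
      shiftCoeff s (q⁻¹ * x) y (q * z) =
        (1 - s * x * y * z) * (q ^ 2 * z - s * x * y) /
          (s * z * (x ^ 2 - q ^ 2) * (y ^ 2 - 1)) := by
    have h6 := sub_ne_zero.mpr hy2
    rw [shiftCoeff_eq hs (mul_ne_zero (inv_ne_zero hq) hx) hy (mul_ne_zero hq hz) hqx2 hy2]
    field_simp
  rw [shiftCoeff_eq hs hx hz hy hx2 hz2, shiftCoeff_eq hs hx hy hz hx2 hy2,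
    inv_left hy hz hz2, inv_left hz hy hy2, shift_inv_left hy hz hy2, shift_inv_left hz hy hz2,
    shift_left hy hz hy2, shift_left hz hy hz2]
  rw [mul_comm (q ^ 2)] at h4
  field_simp
  ring

end Identities

section Commutation

variable {k K : Type*} [Field k] [Field K] [Algebra k K]

theorem map_shiftCoeff (α : K ≃ₐ[k] K) (s x z y : K) :
    α (shiftCoeff s x z y) = shiftCoeff (α s) (α x) (α z) (α y) := by
  simp [shiftCoeff]

theorem symm_apply_of_apply_eq_mul {α : K ≃ₐ[k] K} {q : k} (hq : q ≠ 0) {x : K}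
    (h : α x = algebraMap k K q * x) : α.symm x = (algebraMap k K q)⁻¹ * x := by
  rw [AlgEquiv.symm_apply_eq, map_mul, map_inv₀, AlgEquiv.commutes, h, inv_mul_cancel_left₀]
  simpa using hq

theorem symm_apply_of_apply_eq {α : K ≃ₐ[k] K} {x : K} (h : α x = x) : α.symm x = x := by
  rw [AlgEquiv.symm_apply_eq, h]

theorem symm_apply_comm {α β : K ≃ₐ[k] K} (h : ∀ f, α (β f) = β (α f)) (f : K) :
    α.symm (β f) = β (α.symm f) := by
  rw [AlgEquiv.symm_apply_eq, h, AlgEquiv.apply_symm_apply]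

theorem shiftOp_comm {α β : K ≃ₐ[k] K} (h : ∀ f, α (β f) = β (α f)) (s x z y f : K) :
    shiftOp s x z y α β f = shiftOp s z x y β α f := by
  have h1 := symm_apply_comm h
  have h2 := symm_apply_comm fun f => (h f).symm
  have h3 := symm_apply_comm fun f => (h2 f).symm
  simp only [shiftOp, h, h1, h2, h3, shiftCoeff_comm s x, shiftCoeff_comm s x⁻¹]
  ring

theorem shiftOp_shiftOp {α β γ : K ≃ₐ[k] K} (hαβ : ∀ f, β (α f) = α (β f))
    (hαγ : ∀ f, γ (α f) = α (γ f)) (hβγ : ∀ f, γ (β f) = β (γ f)) {s q : k} (hs : s ≠ 0)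
    (hq : q ≠ 0) {x y z : K} (hx : x ≠ 0) (hy : y ≠ 0) (hz : z ≠ 0) (hx2 : x ^ 2 ≠ 1)
    (hy2 : y ^ 2 ≠ 1) (hz2 : z ^ 2 ≠ 1) (hqx : (algebraMap k K q * x) ^ 2 ≠ 1)
    (hqx' : x ^ 2 ≠ algebraMap k K q ^ 2)
    (hαx : α x = algebraMap k K q * x) (hαy : α y = y) (hαz : α z = z)
    (hβx : β x = x) (hβy : β y = algebraMap k K q * y) (hβz : β z = z)
    (hγx : γ x = x) (hγy : γ y = y) (hγz : γ z = algebraMap k K q * z) (f : K) :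
    shiftOp (algebraMap k K s) x z y α γ (shiftOp (algebraMap k K s) x y z α β f) =
      shiftOp (algebraMap k K s) x y z α β (shiftOp (algebraMap k K s) x z y α γ f) := by
  have a1 := symm_apply_of_apply_eq_mul hq hαx
  have a2 := symm_apply_of_apply_eq hαy
  have a3 := symm_apply_of_apply_eq hαz
  have b1 := symm_apply_of_apply_eq hβx
  have b2 := symm_apply_of_apply_eq_mul hq hβy
  have b3 := symm_apply_of_apply_eq hβz
  have c1 := symm_apply_of_apply_eq hγx
  have c2 := symm_apply_of_apply_eq hγy
  have c3 := symm_apply_of_apply_eq_mul hq hγz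
  have d1 := symm_apply_comm hαβ
  have d2 := fun f => (symm_apply_comm (fun f => (hαβ f).symm) f).symm
  have d3 := fun f => (symm_apply_comm (fun f => (d1 f).symm) f).symm
  have e1 := symm_apply_comm hαγ
  have e2 := fun f => (symm_apply_comm (fun f => (hαγ f).symm) f).symm
  have e3 := fun f => (symm_apply_comm (fun f => (e1 f).symm) f).symm
  have f1 := symm_apply_comm hβγ
  have f2 := fun f => (symm_apply_comm (fun f => (hβγ f).symm) f).symm
  have f3 := fun f => (symm_apply_comm (fun f => (f1 f).symm) f).symm
  have hs' : algebraMap k K s ≠ 0 := by simpa using hs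
  have hq' : algebraMap k K q ≠ 0 := by simpa using hq
  simp only [shiftOp, map_add, map_mul, map_shiftCoeff, map_inv₀, AlgEquiv.commutes,
    hαx, hαy, hαz, hβx, hβy, hβz, hγx, hγy, hγz, a1, a2, a3, b1, b2, b3, c1, c2, c3,
    hαβ, hαγ, hβγ, d1, d2, d3, e1, e2, e3, f1, f2, f3, AlgEquiv.apply_symm_apply,
    AlgEquiv.symm_apply_apply]
  generalize algebraMap k K s = s at *
  generalize algebraMap k K q = q at *
  have shift_inv (u v w : K) : shiftCoeff s u v (q⁻¹ * w) = shiftCoeff s u v (q * w⁻¹) := by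
    rw [← shiftCoeff_inv, mul_inv, inv_inv]
  simp only [shift_inv, mul_inv, inv_inv]
  have hx' := inv_ne_zero hx
  have hy' := inv_ne_zero hy
  have hz' := inv_ne_zero hz
  have hx2' : x⁻¹ ^ 2 ≠ 1 := by simpa using hx2
  have hy2' : y⁻¹ ^ 2 ≠ 1 := by simpa using hy2
  have hz2' : z⁻¹ ^ 2 ≠ 1 := by simpa using hz2
  have hqx2 : (q * x⁻¹) ^ 2 ≠ 1 := by
    rwa [mul_pow, inv_pow, ne_eq, mul_inv_eq_one₀ (pow_ne_zero 2 hx), eq_comm]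
  linear_combination (norm := (simp only [shiftCoeff_inv]; ring))
    α (α (β (γ f))) * shiftCoeff_mul_same hs' hq' hx hy hz hx2 hy2 hz2 hqx
    + α (α (β (γ.symm f))) * shiftCoeff_mul_same hs' hq' hx hy hz' hx2 hy2 hz2' hqx
    + α (α (β.symm (γ f))) * shiftCoeff_mul_same hs' hq' hx hy' hz hx2 hy2' hz2 hqx
    + α (α (β.symm (γ.symm f))) * shiftCoeff_mul_same hs' hq' hx hy' hz' hx2 hy2' hz2' hqx
    + α.symm (α.symm (β (γ f))) * shiftCoeff_mul_same hs' hq' hx' hy hz hx2' hy2 hz2 hqx2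
    + α.symm (α.symm (β (γ.symm f))) *
      shiftCoeff_mul_same hs' hq' hx' hy hz' hx2' hy2 hz2' hqx2
    + α.symm (α.symm (β.symm (γ f))) *
      shiftCoeff_mul_same hs' hq' hx' hy' hz hx2' hy2' hz2 hqx2
    + α.symm (α.symm (β.symm (γ.symm f))) *
      shiftCoeff_mul_same hs' hq' hx' hy' hz' hx2' hy2' hz2' hqx2
    + β (γ f) * shiftCoeff_mul_opposite hs' hq' hx hy hz hx2 hy2 hz2 hqx hqx'
    + β (γ.symm f) * shiftCoeff_mul_opposite hs' hq' hx hy hz' hx2 hy2 hz2' hqx hqx'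
    + β.symm (γ f) * shiftCoeff_mul_opposite hs' hq' hx hy' hz hx2 hy2' hz2 hqx hqx'
    + β.symm (γ.symm f) * shiftCoeff_mul_opposite hs' hq' hx hy' hz' hx2 hy2' hz2' hqx hqx'

end Commutation

section FunctionField

theorem algebraMap_kk_eq (a : kk) :
    algebraMap kk KK a = algebraMap (MvPolynomial (Fin 3) kk) KK (MvPolynomial.C a) :=
  IsScalarTower.algebraMap_apply kk (MvPolynomial (Fin 3) kk) KK a

theorem q4_sq_ne_zero : q4 ^ 2 ≠ 0 := by
  refine pow_ne_zero 2 fun h => MvPolynomial.X_ne_zero (R := ℂ) (0 : Fin 2) ?_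
  exact (IsFractionRing.injective (MvPolynomial (Fin 2) ℂ) kk) (h.trans (map_zero _).symm)

theorem t4_sq_ne_zero : t4 ^ 2 ≠ 0 := by
  refine pow_ne_zero 2 fun h => MvPolynomial.X_ne_zero (R := ℂ) (1 : Fin 2) ?_
  exact (IsFractionRing.injective (MvPolynomial (Fin 2) ℂ) kk) (h.trans (map_zero _).symm)

theorem algebraMap_X_ne_zero (i : Fin 3) :
    algebraMap (MvPolynomial (Fin 3) kk) KK (MvPolynomial.X i) ≠ 0 := fun h =>
  MvPolynomial.X_ne_zero (R := kk) i
    ((IsFractionRing.injective (MvPolynomial (Fin 3) kk) KK) (h.trans (map_zero _).symm))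

theorem mul_algebraMap_X_sq_ne (i : Fin 3) (a : kk) {b : kk} (hb : b ≠ 0) :
    (algebraMap kk KK a * algebraMap (MvPolynomial (Fin 3) kk) KK (MvPolynomial.X i)) ^ 2 ≠
      algebraMap kk KK b := by
  intro h
  rw [algebraMap_kk_eq, algebraMap_kk_eq, ← map_mul, ← map_pow] at h
  have h' := IsFractionRing.injective (MvPolynomial (Fin 3) kk) KK h
  apply hb
  simpa using (congrArg (MvPolynomial.eval 0) h').symm

theorem algebraMap_X_sq_ne (i : Fin 3) {b : kk} (hb : b ≠ 0) :
    algebraMap (MvPolynomial (Fin 3) kk) KK (MvPolynomial.X i) ^ 2 ≠ algebraMap kk KK b := by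
  simpa only [map_one, one_mul] using mul_algebraMap_X_sq_ne i 1 hb

theorem algEquiv_ext {δ ε : KK ≃ₐ[kk] KK} (h12 : δ X12 = ε X12) (h23 : δ X23 = ε X23)
    (h13 : δ X13 = ε X13) (f : KK) : δ f = ε f := by
  have h : δ.toAlgHom.comp (IsScalarTower.toAlgHom kk (MvPolynomial (Fin 3) kk) KK) =
      ε.toAlgHom.comp (IsScalarTower.toAlgHom kk (MvPolynomial (Fin 3) kk) KK) := by
    apply MvPolynomial.algHom_ext
    intro i
    fin_cases i
    exacts [h12, h23, h13]
  obtain ⟨a, b, -, rfl⟩ := IsFractionRing.div_surjective (A := MvPolynomial (Fin 3) kk) f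
  have ha : δ (algebraMap _ KK a) = ε (algebraMap _ KK a) := DFunLike.congr_fun h a
  have hb : δ (algebraMap _ KK b) = ε (algebraMap _ KK b) := DFunLike.congr_fun h b
  rw [map_div₀, map_div₀, ha, hb]

theorem apply_comm_of_apply_eq_mul {δ ε : KK ≃ₐ[kk] KK} {a b c a' b' c' : kk}
    (h12 : δ X12 = algebraMap kk KK a * X12) (h23 : δ X23 = algebraMap kk KK b * X23)
    (h13 : δ X13 = algebraMap kk KK c * X13) (h12' : ε X12 = algebraMap kk KK a' * X12)
    (h23' : ε X23 = algebraMap kk KK b' * X23) (h13' : ε X13 = algebraMap kk KK c' * X13)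
    (f : KK) : δ (ε f) = ε (δ f) := by
  refine algEquiv_ext (δ := ε.trans δ) (ε := δ.trans ε) ?_ ?_ ?_ f <;>
  · simp only [AlgEquiv.trans_apply, h12, h23, h13, h12', h23', h13', map_mul,
      AlgEquiv.commutes]
    ring

theorem Ohat1_apply (δ12 δ13 : KK ≃ₐ[kk] KK) (f : KK) :
    Ohat1 δ12 δ13 f = shiftOp st X12 X13 X23 δ12 δ13 f := by
  simp only [Ohat1, Mop, Eop, c1, shiftOp, shiftCoeff, LinearMap.add_apply, LinearMap.sub_apply,
    Module.End.mul_apply, LinearMap.mulLeft_apply, AlgEquiv.toLinearMap_apply, zpow_one,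
    zpow_neg_one, inv_inv, ← neg_sub X12 X12⁻¹, ← neg_sub X13 X13⁻¹, mul_neg, neg_mul, neg_neg,
    div_neg]
  ring

theorem Ohat3_apply (δ12 δ23 : KK ≃ₐ[kk] KK) (f : KK) :
    Ohat3 δ12 δ23 f = shiftOp st X12 X23 X13 δ12 δ23 f := by
  simp only [Ohat3, Mop, Eop, c3, shiftOp, shiftCoeff, LinearMap.add_apply, LinearMap.sub_apply,
    Module.End.mul_apply, LinearMap.mulLeft_apply, AlgEquiv.toLinearMap_apply, zpow_one,
    zpow_neg_one, inv_inv, ← neg_sub X12 X12⁻¹, ← neg_sub X23 X23⁻¹, mul_neg, neg_mul, neg_neg,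
    div_neg]
  ring

theorem Ohat5_apply (δ13 δ23 : KK ≃ₐ[kk] KK) (f : KK) :
    Ohat5 δ13 δ23 f = shiftOp st X13 X23 X12 δ13 δ23 f := by
  simp only [Ohat5, Mop, Eop, c5, shiftOp, shiftCoeff, LinearMap.add_apply, LinearMap.sub_apply,
    Module.End.mul_apply, LinearMap.mulLeft_apply, AlgEquiv.toLinearMap_apply, zpow_one,
    zpow_neg_one, inv_inv, ← neg_sub X13 X13⁻¹, ← neg_sub X23 X23⁻¹, mul_neg, neg_mul, neg_neg,
    div_neg]
  ring

end FunctionField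

/-- the operators `Ô₁`, `Ô₃`, `Ô₅` pairwise commute. -/
theorem Ohat1_Ohat3_Ohat5_pairwise_commute
    (δ12 δ23 δ13 : KK ≃ₐ[kk] KK)
    (h12x : δ12 X12 = qh * X12) (h12y : δ12 X23 = X23) (h12z : δ12 X13 = X13)
    (h23x : δ23 X12 = X12) (h23y : δ23 X23 = qh * X23) (h23z : δ23 X13 = X13)
    (h13x : δ13 X12 = X12) (h13y : δ13 X23 = X23) (h13z : δ13 X13 = qh * X13) :
    Ohat1 δ12 δ13 * Ohat3 δ12 δ23 = Ohat3 δ12 δ23 * Ohat1 δ12 δ13 ∧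
    Ohat1 δ12 δ13 * Ohat5 δ13 δ23 = Ohat5 δ13 δ23 * Ohat1 δ12 δ13 ∧
    Ohat3 δ12 δ23 * Ohat5 δ13 δ23 = Ohat5 δ13 δ23 * Ohat3 δ12 δ23 := by
  have sq_ne_one (i : Fin 3) :
      algebraMap (MvPolynomial (Fin 3) kk) KK (MvPolynomial.X i) ^ 2 ≠ 1 := by
    simpa only [map_one] using algebraMap_X_sq_ne i one_ne_zero
  have mul_sq_ne_one (i : Fin 3) :
      (qh * algebraMap (MvPolynomial (Fin 3) kk) KK (MvPolynomial.X i)) ^ 2 ≠ 1 := by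
    simpa only [qh, map_one] using mul_algebraMap_X_sq_ne i (q4 ^ 2) one_ne_zero
  have sq_ne_sq (i : Fin 3) :
      algebraMap (MvPolynomial (Fin 3) kk) KK (MvPolynomial.X i) ^ 2 ≠ qh ^ 2 := by
    rw [qh, ← map_pow (algebraMap kk KK)]
    exact algebraMap_X_sq_ne i (pow_ne_zero 2 q4_sq_ne_zero)
  have one_mul' (x : KK) : x = algebraMap kk KK 1 * x := by rw [map_one, one_mul]
  have comm_12_23 := apply_comm_of_apply_eq_mul h12x (h12y.trans (one_mul' _))
    (h12z.trans (one_mul' _)) (h23x.trans (one_mul' _)) h23y (h23z.trans (one_mul' _))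
  have comm_12_13 := apply_comm_of_apply_eq_mul h12x (h12y.trans (one_mul' _))
    (h12z.trans (one_mul' _)) (h13x.trans (one_mul' _)) (h13y.trans (one_mul' _)) h13z
  have comm_13_23 := apply_comm_of_apply_eq_mul (h13x.trans (one_mul' _))
    (h13y.trans (one_mul' _)) h13z (h23x.trans (one_mul' _)) h23y (h23z.trans (one_mul' _))
  have hX := algebraMap_X_ne_zero
  refine ⟨LinearMap.ext fun f => ?_, LinearMap.ext fun f => ?_, LinearMap.ext fun f => ?_⟩
  · simp only [Module.End.mul_apply, Ohat1_apply, Ohat3_apply]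
    exact shiftOp_shiftOp (fun f => (comm_12_23 f).symm) (fun f => (comm_12_13 f).symm)
      comm_13_23 t4_sq_ne_zero q4_sq_ne_zero (hX 0) (hX 1) (hX 2) (sq_ne_one 0) (sq_ne_one 1)
      (sq_ne_one 2) (mul_sq_ne_one 0) (sq_ne_sq 0) h12x h12y h12z h23x h23y h23z h13x h13y h13z f
  · simp only [Module.End.mul_apply, Ohat1_apply, Ohat5_apply, shiftOp_comm comm_12_13]
    exact shiftOp_shiftOp (fun f => (comm_13_23 f).symm) comm_12_13 comm_12_23
      t4_sq_ne_zero q4_sq_ne_zero (hX 2) (hX 1) (hX 0) (sq_ne_one 2) (sq_ne_one 1)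
      (sq_ne_one 0) (mul_sq_ne_one 2) (sq_ne_sq 2) h13z h13y h13x h23z h23y h23x h12z h12y h12x f
  · simp only [Module.End.mul_apply, Ohat3_apply, Ohat5_apply, shiftOp_comm comm_12_23,
      shiftOp_comm comm_13_23]
    exact shiftOp_shiftOp comm_13_23 comm_12_23 comm_12_13
      t4_sq_ne_zero q4_sq_ne_zero (hX 1) (hX 2) (hX 0) (sq_ne_one 1) (sq_ne_one 2)
      (sq_ne_one 0) (mul_sq_ne_one 1) (sq_ne_sq 1) h23y h23z h23x h13y h13z h13x h12y h12z h12x f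
end
end

section
/- The following three equalities of 𝐤-linear endomorphisms of K hold: [[Ô₁,Ô₂]_q, Ô₃]_q = [[Ô₄,Ô₅]_q, Ô₆]_q, [[Ô₂,Ô₃]_q, Ô₄]_q = [[Ô₅,Ô₆]_q, Ô₁]_q, and [[Ô₃,Ô₄]_q, Ô₅]_q = [[Ô₆,Ô₁]_q, Ô₂]_q. -/
set_option synthInstance.maxHeartbeats 1000000
set_option maxHeartbeats 4000000

noncomputable section

/-- `Ô₂` : multiplication by `X₁₂ + X₁₂⁻¹`. -/
def Ohat2 : Module.End kk KK := Mop (X12 + X12⁻¹)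

/-- `Ô₄` : multiplication by `X₂₃ + X₂₃⁻¹`. -/
def Ohat4 : Module.End kk KK := Mop (X23 + X23⁻¹)

/-- `Ô₆` : multiplication by `X₁₃ + X₁₃⁻¹`. -/
def Ohat6 : Module.End kk KK := Mop (X13 + X13⁻¹)

/-- The `q`-commutator `[A,B]_{q^j} = (q^{j/4}·A∘B − q^{−j/4}·B∘A)/(q^{1/2}−q^{−1/2})`. -/
def qcomm (j : ℤ) (A B : Module.End kk KK) : Module.End kk KK :=
  (q4 ^ 2 - (q4 ^ 2)⁻¹)⁻¹ • ((q4 ^ j) • (A * B) - (q4 ^ j)⁻¹ • (B * A))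

/-- The coefficient of the shift operators, with `u`, `v` the shifted variables. -/
def askeyCoeff {F : Type*} [Field F] (t u v w : F) : F :=
  (1 - t * u * v * w) * (1 - t * u * v * w⁻¹) / (t * (u ^ 2 - 1) * (v ^ 2 - 1))

theorem askeyCoeff_same {F : Type*} [Field F] {s t x y z : F} (hy : y ≠ 0)
    (hz : z ≠ 0) (hs : s ≠ 0) :
    s * (x * askeyCoeff t x z y * askeyCoeff t (s * x) y (s * z)) =
      askeyCoeff t x y z * (s * x * askeyCoeff t (s * x) z (s * y)) := by
  simp only [askeyCoeff, div_eq_mul_inv, mul_inv]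
  field_simp

theorem askeyCoeff_opposite {F : Type*} [Field F] {s t x y z : F} (hs : s ≠ 0) (ht : t ≠ 0)
    (hx : x ≠ 0) (hy : y ≠ 0) (hz : z ≠ 0) (hx1 : x ^ 2 ≠ 1) (hy1 : y ^ 2 ≠ 1) (hz1 : z ^ 2 ≠ 1)
    (hsx : s ^ 2 * x ^ 2 ≠ 1) (hxs : x ^ 2 ≠ s ^ 2) :
    s * (x * askeyCoeff t x z y * askeyCoeff t (s⁻¹ * x⁻¹) y (s * z)) -
        askeyCoeff t x y z * (s⁻¹ * x⁻¹ * askeyCoeff t (s⁻¹ * x⁻¹) z (s * y)) +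
      (s * (x⁻¹ * askeyCoeff t x⁻¹ z y * askeyCoeff t (s⁻¹ * x) y (s * z)) -
        askeyCoeff t x⁻¹ y z * (s⁻¹ * x * askeyCoeff t (s⁻¹ * x) z (s * y))) =
      (s - s⁻¹) * (z * (y⁻¹ * askeyCoeff t z y x)) := by
  have e1 : x ^ 2 - 1 ≠ 0 := sub_ne_zero.2 hx1
  have e2 : y ^ 2 - 1 ≠ 0 := sub_ne_zero.2 hy1
  have e3 : z ^ 2 - 1 ≠ 0 := sub_ne_zero.2 hz1
  have e4 : s ^ 2 * x ^ 2 - 1 ≠ 0 := sub_ne_zero.2 hsx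
  have e5 : x ^ 2 - s ^ 2 ≠ 0 := sub_ne_zero.2 hxs
  have f1 : (x⁻¹) ^ 2 - 1 = -(x ^ 2 - 1) / x ^ 2 := by field_simp; ring
  have f4 : (s⁻¹ * x⁻¹) ^ 2 - 1 = -(s ^ 2 * x ^ 2 - 1) / (s ^ 2 * x ^ 2) := by field_simp; ring
  have f5 : (s⁻¹ * x) ^ 2 - 1 = (x ^ 2 - s ^ 2) / s ^ 2 := by field_simp
  simp only [askeyCoeff, f1, f4, f5]
  field_simp
  ring

section Twist

variable {k F : Type*} [Field k] [Field F] [Algebra k F]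

/-- The operator `f ↦ g · σ f`. -/
def twist (g : F) (σ : F ≃ₐ[k] F) : Module.End k F :=
  LinearMap.mulLeft k g * (σ.toLinearMap : F →ₗ[k] F)

@[simp]
theorem twist_apply (g : F) (σ : F ≃ₐ[k] F) (f : F) : twist g σ f = g * σ f := rfl

theorem twist_mul_twist (g h : F) (σ τ : F ≃ₐ[k] F) :
    twist g σ * twist h τ = twist (g * σ h) (σ * τ) := by
  ext f
  simp [Module.End.mul_apply, AlgEquiv.mul_apply, mul_assoc]

theorem twist_add (g h : F) (σ : F ≃ₐ[k] F) : twist g σ + twist h σ = twist (g + h) σ := by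
  ext f
  simp [add_mul]

theorem twist_sub (g h : F) (σ : F ≃ₐ[k] F) : twist g σ - twist h σ = twist (g - h) σ := by
  ext f
  simp [sub_mul]

theorem smul_twist (c : k) (g : F) (σ : F ≃ₐ[k] F) :
    c • twist g σ = twist (algebraMap k F c * g) σ := by
  ext f
  simp [Algebra.smul_def, mul_assoc]

/-- The `q`-commutator `(r AB - r⁻¹ BA) / (r² - r⁻²)`. -/
def qBracket (r : k) (A B : Module.End k F) : Module.End k F :=
  (r ^ 2 - (r ^ 2)⁻¹)⁻¹ • (r • (A * B) - r⁻¹ • (B * A))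

theorem qBracket_sum_left {ι : Type*} (s : Finset ι) (r : k) (A : ι → Module.End k F)
    (B : Module.End k F) : qBracket r (∑ i ∈ s, A i) B = ∑ i ∈ s, qBracket r (A i) B := by
  simp only [qBracket, Finset.sum_mul, Finset.mul_sum, Finset.smul_sum,
    ← Finset.sum_sub_distrib]

theorem qBracket_sum_right {ι : Type*} (s : Finset ι) (r : k) (A : Module.End k F)
    (B : ι → Module.End k F) : qBracket r A (∑ i ∈ s, B i) = ∑ i ∈ s, qBracket r A (B i) := by
  simp only [qBracket, Finset.sum_mul, Finset.mul_sum, Finset.smul_sum,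
    ← Finset.sum_sub_distrib]

theorem qBracket_smul_left (r c : k) (A B : Module.End k F) :
    qBracket r (c • A) B = c • qBracket r A B := by
  simp only [qBracket, smul_mul_assoc, mul_smul_comm, smul_sub, smul_smul]
  congr 2 <;> ring

theorem qBracket_twist {r : k} {σ τ : F ≃ₐ[k] F} (h : Commute σ τ) (f g : F) :
    qBracket r (twist f σ) (twist g τ) =
      twist (algebraMap k F ((r ^ 2 - (r ^ 2)⁻¹)⁻¹ * r⁻¹) *
        (algebraMap k F (r ^ 2) * (f * σ g) - g * τ f)) (σ * τ) := by
  by_cases hr : r = 0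
  · subst hr
    ext f
    simp [qBracket]
  have hr' : algebraMap k F r ≠ 0 := by simpa using hr
  simp only [qBracket, twist_mul_twist, ← h.eq, smul_twist, twist_sub]
  congr 1
  simp only [map_mul, map_inv₀, map_pow, map_sub]
  field_simp

theorem sq_sub_inv_sq_ne_zero {r : k} (hr : r ≠ 0) (hr4 : r ^ 4 ≠ 1) :
    r ^ 2 - (r ^ 2)⁻¹ ≠ 0 := by
  intro h
  apply hr4
  field_simp at h
  linear_combination h

theorem mulLeft_eq_twist (g : F) : LinearMap.mulLeft k g = twist g (1 : F ≃ₐ[k] F) := rfl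

theorem qBracket_twist_mulLeft {r : k} (hr : r ≠ 0) (hr4 : r ^ 4 ≠ 1) {x : F} (hx : x ≠ 0)
    {σ : F ≃ₐ[k] F} (h : σ x = algebraMap k F (r ^ 2) * x) (g : F) :
    qBracket r (twist g σ) (LinearMap.mulLeft k (x + x⁻¹)) = r • twist (x * g) σ := by
  have h0 : algebraMap k F r ≠ 0 := by simpa using hr
  have h1 := (map_ne_zero (algebraMap k F)).2 (sq_sub_inv_sq_ne_zero hr hr4)
  rw [mulLeft_eq_twist, qBracket_twist (Commute.one_right σ), smul_twist, mul_one, map_mul,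
    map_inv₀, mul_assoc]
  congr 1
  rw [inv_mul_eq_iff_eq_mul₀ h1]
  simp only [map_add, map_inv₀, h, map_sub, map_pow, AlgEquiv.one_apply]
  field_simp
  ring

theorem qBracket_mulLeft_twist {r : k} (hr : r ≠ 0) (hr4 : r ^ 4 ≠ 1) {x : F} (hx : x ≠ 0)
    {σ : F ≃ₐ[k] F} (h : σ x = algebraMap k F (r ^ 2) * x) (g : F) :
    qBracket r (LinearMap.mulLeft k (x + x⁻¹)) (twist g σ) = r⁻¹ • twist (x⁻¹ * g) σ := by
  have h0 : algebraMap k F r ≠ 0 := by simpa using hr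
  have h1 := (map_ne_zero (algebraMap k F)).2 (sq_sub_inv_sq_ne_zero hr hr4)
  rw [mulLeft_eq_twist, qBracket_twist (Commute.one_left σ), smul_twist, one_mul, map_mul,
    map_inv₀, mul_assoc]
  congr 1
  rw [inv_mul_eq_iff_eq_mul₀ h1]
  simp only [map_add, map_inv₀, h, map_sub, map_pow, AlgEquiv.one_apply]
  field_simp
  ring

theorem zpow_units_add_inv (x : F) (e : ℤˣ) :
    x ^ (e : ℤ) + (x ^ (e : ℤ))⁻¹ = x + x⁻¹ := by
  rcases Int.units_eq_one_or e with rfl | rfl <;> simp [add_comm]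

theorem zpow_units_apply_of_fixed {σ : F ≃ₐ[k] F} {y : F} (h : σ y = y) (e : ℤˣ) :
    (σ ^ (e : ℤ)) y = y := by
  have h' : σ.symm y = y := by rw [AlgEquiv.symm_apply_eq, h]
  rcases Int.units_eq_one_or e with rfl | rfl <;> simp [h, AlgEquiv.aut_inv, h']

theorem zpow_units_apply_zpow {σ : F ≃ₐ[k] F} {x : F} {c : k} (hc : c ≠ 0)
    (h : σ x = algebraMap k F c * x) (e : ℤˣ) :
    (σ ^ (e : ℤ)) (x ^ (e : ℤ)) = algebraMap k F c * x ^ (e : ℤ) := by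
  have hc' : algebraMap k F c ≠ 0 := by simpa using hc
  have h' : σ.symm x = (algebraMap k F c)⁻¹ * x := by
    rw [AlgEquiv.symm_apply_eq, map_mul, map_inv₀, h, AlgEquiv.commutes]
    field_simp
  rcases Int.units_eq_one_or e with rfl | rfl <;> simp [h, AlgEquiv.aut_inv, h', mul_comm]

theorem askeyCoeff_zpow_units (t u v w : F) (e : ℤˣ) :
    askeyCoeff t u v (w ^ (e : ℤ)) = askeyCoeff t u v w := by
  rcases Int.units_eq_one_or e with rfl | rfl
  · simp
  · simp [askeyCoeff, mul_comm (1 - t * u * v * w⁻¹)]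

theorem askeyCoeff_comm (t u v w : F) : askeyCoeff t u v w = askeyCoeff t v u w := by
  simp only [askeyCoeff]
  ring

theorem map_askeyCoeff (σ : F ≃ₐ[k] F) (t u v w : F) :
    σ (askeyCoeff t u v w) = askeyCoeff (σ t) (σ u) (σ v) (σ w) := by
  simp [askeyCoeff]

/-- The difference operator shifting `u` and `v`, with parameter `w`. -/
def askeyOp (t u v w : F) (du dv : F ≃ₐ[k] F) : Module.End k F :=
  ∑ a : ℤˣ, ∑ b : ℤˣ, twist (askeyCoeff t (u ^ (a : ℤ)) (v ^ (b : ℤ)) w)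
    (du ^ (a : ℤ) * dv ^ (b : ℤ))

theorem askeyOp_comm (t u v w : F) {du dv : F ≃ₐ[k] F} (h : Commute du dv) :
    askeyOp t u v w du dv = askeyOp t v u w dv du := by
  rw [askeyOp, askeyOp, Finset.sum_comm]
  refine Finset.sum_congr rfl fun b _ => Finset.sum_congr rfl fun a _ => ?_
  rw [askeyCoeff_comm, (h.zpow_zpow _ _).eq]

theorem sum_intUnits_eq {M : Type*} [AddCommMonoid M] (f : ℤˣ → M) (a : ℤˣ) :
    ∑ e : ℤˣ, f e = f a + f (-a) := by
  have h : (Finset.univ : Finset ℤˣ) = {1, -1} := rfl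
  rw [h, Finset.sum_pair (by decide)]
  rcases Int.units_eq_one_or a with rfl | rfl
  · rfl
  · rw [neg_neg, add_comm]

/-- `d` acts as the shift `u ↦ c u`, fixing `v`, `w`. -/
structure IsShift (d : F ≃ₐ[k] F) (c : k) (u v w : F) : Prop where
  shift : d u = algebraMap k F c * u
  fix_left : d v = v
  fix_right : d w = w

theorem qBracket_askeyOp {r : k} {t x y z : F} {τ : k} {dx dy dz : F ≃ₐ[k] F}
    (hr : r ≠ 0) (hr4 : r ^ 4 ≠ 1) (ht : t ≠ 0) (hτ : algebraMap k F τ = t)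
    (hx : ∀ c : k, x ^ 2 ≠ algebraMap k F c) (hy : ∀ c : k, y ^ 2 ≠ algebraMap k F c)
    (hz : ∀ c : k, z ^ 2 ≠ algebraMap k F c)
    (hdx : IsShift dx (r ^ 2) x y z) (hdy : IsShift dy (r ^ 2) y x z)
    (hdz : IsShift dz (r ^ 2) z x y)
    (hxy : Commute dx dy) (hxz : Commute dx dz) (hyz : Commute dy dz) :
    qBracket r (qBracket r (askeyOp t x z y dx dz) (LinearMap.mulLeft k (x + x⁻¹)))
        (askeyOp t x y z dx dy) =
      qBracket r (qBracket r (LinearMap.mulLeft k (y + y⁻¹)) (askeyOp t z y x dz dy))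
        (LinearMap.mulLeft k (z + z⁻¹)) := by
  have ne0 {u : F} (hu : ∀ c : k, u ^ 2 ≠ algebraMap k F c) (e : ℤˣ) : u ^ (e : ℤ) ≠ 0 :=
    zpow_ne_zero _ fun h => hu 0 (by simp [h])
  have hne {u : F} (hu : ∀ c : k, u ^ 2 ≠ algebraMap k F c) (e : ℤˣ) (c : k) (hc : c ≠ 0) :
      (u ^ (e : ℤ)) ^ 2 ≠ algebraMap k F c := by
    rcases Int.units_eq_one_or e with rfl | rfl
    · simpa using hu c
    · intro h
      apply hu c⁻¹
      rw [map_inv₀, ← h]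
      simp
  have fixt (σ : F ≃ₐ[k] F) : σ t = t := by rw [← hτ, σ.commutes]
  have hr2 : r ^ 2 ≠ 0 := pow_ne_zero 2 hr
  have hs : algebraMap k F (r ^ 2) ≠ 0 := by simpa using hr
  have fixz {σ : F ≃ₐ[k] F} {u : F} (h : σ u = u) (e : ℤˣ) : σ (u ^ (e : ℤ)) = u ^ (e : ℤ) := by
    rw [map_zpow₀, h]
  have key (b c : ℤˣ) :
      ∑ a : ℤˣ, ∑ a' : ℤˣ,
        qBracket r (twist (x ^ (a : ℤ) * askeyCoeff t (x ^ (a : ℤ)) (z ^ (b : ℤ)) y)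
            (dx ^ (a : ℤ) * dz ^ (b : ℤ)))
          (twist (askeyCoeff t (x ^ (a' : ℤ)) (y ^ (c : ℤ)) z)
            (dx ^ (a' : ℤ) * dy ^ (c : ℤ))) =
      r⁻¹ • twist (z ^ (b : ℤ) *
        ((y ^ (c : ℤ))⁻¹ * askeyCoeff t (z ^ (b : ℤ)) (y ^ (c : ℤ)) x))
          (dz ^ (b : ℤ) * dy ^ (c : ℤ)) := by
    have comm (a a' : ℤˣ) :
        Commute (dx ^ (a : ℤ) * dz ^ (b : ℤ)) (dx ^ (a' : ℤ) * dy ^ (c : ℤ)) :=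
      Commute.mul_left
        (Commute.mul_right ((Commute.refl dx).zpow_zpow _ _) (hxy.zpow_zpow _ _))
        (Commute.mul_right (hxz.symm.zpow_zpow _ _) (hyz.symm.zpow_zpow _ _))
    have sx (a : ℤˣ) := zpow_units_apply_zpow hr2 hdx.shift a
    have sy := zpow_units_apply_zpow hr2 hdy.shift c
    have sz := zpow_units_apply_zpow hr2 hdz.shift b
    have fxy (a e : ℤˣ) := fixz (zpow_units_apply_of_fixed hdx.fix_left a) e
    have fxz (a e : ℤˣ) := fixz (zpow_units_apply_of_fixed hdx.fix_right a) e
    have fyx (a e : ℤˣ) := fixz (zpow_units_apply_of_fixed hdy.fix_left a) e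
    have fyz (a e : ℤˣ) := fixz (zpow_units_apply_of_fixed hdy.fix_right a) e
    have fzx (a e : ℤˣ) := fixz (zpow_units_apply_of_fixed hdz.fix_left a) e
    have fzy (a e : ℤˣ) := fixz (zpow_units_apply_of_fixed hdz.fix_right a) e
    simp only [← askeyCoeff_zpow_units t _ _ y c, ← askeyCoeff_zpow_units t _ _ z b]
    have same (a : ℤˣ) :
        qBracket r (twist (x ^ (a : ℤ) * askeyCoeff t (x ^ (a : ℤ)) (z ^ (b : ℤ)) (y ^ (c : ℤ)))
            (dx ^ (a : ℤ) * dz ^ (b : ℤ)))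
          (twist (askeyCoeff t (x ^ (a : ℤ)) (y ^ (c : ℤ)) (z ^ (b : ℤ)))
            (dx ^ (a : ℤ) * dy ^ (c : ℤ))) = 0 := by
      rw [qBracket_twist (comm a a)]
      simp only [map_mul, map_askeyCoeff, AlgEquiv.mul_apply, fixt, sx, sy, sz, fxy, fxz, fyx, fyz,
        fzx, fzy, AlgEquiv.commutes]
      rw [← map_mul, askeyCoeff_same (ne0 hy c) (ne0 hz b) hs, sub_self]
      ext f
      simp
    have inv_zpow (u : F) (a : ℤˣ) : u ^ ((-a : ℤˣ) : ℤ) = (u ^ (a : ℤ))⁻¹ := by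
      rw [Units.val_neg, zpow_neg]
    have opp (a : ℤˣ) :
        qBracket r (twist (x ^ (a : ℤ) * askeyCoeff t (x ^ (a : ℤ)) (z ^ (b : ℤ)) (y ^ (c : ℤ)))
            (dx ^ (a : ℤ) * dz ^ (b : ℤ)))
          (twist (askeyCoeff t (x ^ ((-a : ℤˣ) : ℤ)) (y ^ (c : ℤ)) (z ^ (b : ℤ)))
            (dx ^ ((-a : ℤˣ) : ℤ) * dy ^ (c : ℤ))) =
        twist (algebraMap k F ((r ^ 2 - (r ^ 2)⁻¹)⁻¹ * r⁻¹) *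
          (algebraMap k F (r ^ 2) *
              (x ^ (a : ℤ) * askeyCoeff t (x ^ (a : ℤ)) (z ^ (b : ℤ)) (y ^ (c : ℤ)) *
                askeyCoeff t ((algebraMap k F (r ^ 2))⁻¹ * (x ^ (a : ℤ))⁻¹) (y ^ (c : ℤ))
                  (algebraMap k F (r ^ 2) * z ^ (b : ℤ))) -
            askeyCoeff t (x ^ (a : ℤ))⁻¹ (y ^ (c : ℤ)) (z ^ (b : ℤ)) *
              ((algebraMap k F (r ^ 2))⁻¹ * x ^ (a : ℤ) *
                askeyCoeff t ((algebraMap k F (r ^ 2))⁻¹ * x ^ (a : ℤ)) (z ^ (b : ℤ))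
                  (algebraMap k F (r ^ 2) * y ^ (c : ℤ)))))
          (dz ^ (b : ℤ) * dy ^ (c : ℤ)) := by
      have sxn := zpow_units_apply_zpow hr2 hdx.shift (-a)
      rw [inv_zpow, map_inv₀, inv_eq_iff_eq_inv, mul_inv, inv_inv] at sxn
      rw [qBracket_twist (comm a (-a))]
      congr 1
      · simp only [map_mul, map_askeyCoeff, AlgEquiv.mul_apply, fixt, inv_zpow, sx, sxn, sy, sz,
          fxy, fxz, fyx, fyz, fzx, fzy, AlgEquiv.commutes, map_inv₀, mul_inv]
      · rw [Units.val_neg, (hxz.zpow_zpow _ _).eq, mul_assoc, zpow_neg, mul_inv_cancel_left]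
    have h1 := (map_ne_zero (algebraMap k F)).2 (sq_sub_inv_sq_ne_zero hr hr4)
    simp only [fun a : ℤˣ => sum_intUnits_eq (fun a' => qBracket r (twist
        (x ^ (a : ℤ) * askeyCoeff t (x ^ (a : ℤ)) (z ^ (b : ℤ)) (y ^ (c : ℤ)))
          (dx ^ (a : ℤ) * dz ^ (b : ℤ)))
        (twist (askeyCoeff t (x ^ (a' : ℤ)) (y ^ (c : ℤ)) (z ^ (b : ℤ)))
          (dx ^ (a' : ℤ) * dy ^ (c : ℤ)))) a, same, opp, zero_add]
    rw [sum_intUnits_eq _ 1, twist_add, smul_twist]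
    congr 1
    simp only [Units.val_neg, Units.val_one, zpow_neg, zpow_one, inv_inv]
    have h0 := ne0 hx 1
    have hx1 := hne hx 1 1 one_ne_zero
    have hxs := hne hx 1 _ (pow_ne_zero 2 hr2)
    have hsx := hne hx 1 _ (inv_ne_zero (pow_ne_zero 2 hr2))
    have hy1 := hne hy c 1 one_ne_zero
    have hz1 := hne hz b 1 one_ne_zero
    rw [Units.val_one, zpow_one] at h0 hx1 hxs hsx
    rw [map_one] at hx1 hy1 hz1
    rw [map_inv₀, map_pow] at hsx
    replace hsx : algebraMap k F (r ^ 2) ^ 2 * x ^ 2 ≠ 1 := fun h =>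
      hsx (eq_inv_of_mul_eq_one_right h)
    rw [map_pow] at hxs
    have main := askeyCoeff_opposite hs ht h0 (ne0 hy c) (ne0 hz b) hx1 hy1 hz1 hsx hxs
    rw [← mul_add, map_mul, mul_assoc, mul_left_comm, map_inv₀ _ r]
    congr 1
    rw [map_inv₀, inv_mul_eq_iff_eq_mul₀ h1, map_sub, map_inv₀, ← askeyCoeff_zpow_units t _ _ x 1,
      Units.val_one, zpow_one]
    linear_combination main
  have hP : qBracket r (askeyOp t x z y dx dz) (LinearMap.mulLeft k (x + x⁻¹)) =
      r • ∑ a : ℤˣ, ∑ b : ℤˣ, twist (x ^ (a : ℤ) * askeyCoeff t (x ^ (a : ℤ)) (z ^ (b : ℤ)) y)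
        (dx ^ (a : ℤ) * dz ^ (b : ℤ)) := by
    simp only [askeyOp, qBracket_sum_left, Finset.smul_sum]
    refine Finset.sum_congr rfl fun a _ => Finset.sum_congr rfl fun b _ => ?_
    rw [← zpow_units_add_inv x a, qBracket_twist_mulLeft hr hr4 (ne0 hx a)]
    rw [AlgEquiv.mul_apply, fixz (zpow_units_apply_of_fixed hdz.fix_left b),
      zpow_units_apply_zpow hr2 hdx.shift]
  have hQ : qBracket r (qBracket r (LinearMap.mulLeft k (y + y⁻¹)) (askeyOp t z y x dz dy))
      (LinearMap.mulLeft k (z + z⁻¹)) =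
      ∑ b : ℤˣ, ∑ c : ℤˣ, twist (z ^ (b : ℤ) *
        ((y ^ (c : ℤ))⁻¹ * askeyCoeff t (z ^ (b : ℤ)) (y ^ (c : ℤ)) x))
          (dz ^ (b : ℤ) * dy ^ (c : ℤ)) := by
    simp only [askeyOp, qBracket_sum_left, qBracket_sum_right]
    refine Finset.sum_congr rfl fun b _ => Finset.sum_congr rfl fun c _ => ?_
    rw [← zpow_units_add_inv y c, ← zpow_units_add_inv z b,
      qBracket_mulLeft_twist hr hr4 (ne0 hy c), qBracket_smul_left,
      qBracket_twist_mulLeft hr hr4 (ne0 hz b), inv_smul_smul₀ hr]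
    · rw [AlgEquiv.mul_apply, fixz (zpow_units_apply_of_fixed hdy.fix_right c),
        zpow_units_apply_zpow hr2 hdz.shift]
    · rw [AlgEquiv.mul_apply, zpow_units_apply_zpow hr2 hdy.shift, map_mul, AlgEquiv.commutes,
        fixz (zpow_units_apply_of_fixed hdz.fix_right b)]
  rw [hP, hQ, qBracket_smul_left, Finset.sum_comm]
  simp only [askeyOp, qBracket_sum_left, Finset.smul_sum]
  refine Finset.sum_congr rfl fun b _ => ?_
  simp only [qBracket_sum_right]
  rw [← Finset.smul_sum, Finset.sum_congr rfl (fun a _ => Finset.sum_comm), Finset.sum_comm]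
  simp only [key, ← Finset.smul_sum, smul_inv_smul₀ hr]

end Twist

theorem algebraMap_X_pow_ne {σ R L : Type*} [CommRing R] [IsDomain R] [Field L]
    [Algebra (MvPolynomial σ R) L] [IsFractionRing (MvPolynomial σ R) L] (i : σ) {n : ℕ}
    (hn : n ≠ 0) (c : R) :
    algebraMap (MvPolynomial σ R) L (MvPolynomial.X i) ^ n ≠
      algebraMap (MvPolynomial σ R) L (MvPolynomial.C c) := by
  rw [← map_pow, Ne, (IsFractionRing.injective (MvPolynomial σ R) L).eq_iff]
  intro h
  have := congrArg MvPolynomial.totalDegree h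
  rw [MvPolynomial.totalDegree_X_pow, MvPolynomial.totalDegree_C] at this
  exact hn this

theorem q4_ne_zero : q4 ≠ 0 := by
  intro h
  apply algebraMap_X_pow_ne (L := kk) (0 : Fin 2) one_ne_zero (0 : ℂ)
  rw [map_zero, map_zero, pow_one]
  exact h

theorem q4_pow_four_ne_one : q4 ^ 4 ≠ 1 := by
  intro h
  apply algebraMap_X_pow_ne (L := kk) (0 : Fin 2) four_ne_zero (1 : ℂ)
  rw [map_one, map_one]
  exact h

theorem t4_ne_zero : t4 ≠ 0 := by
  intro h
  apply algebraMap_X_pow_ne (L := kk) (1 : Fin 2) one_ne_zero (0 : ℂ)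
  rw [map_zero, map_zero, pow_one]
  exact h

theorem st_ne_zero : st ≠ 0 :=
  (map_ne_zero (algebraMap kk KK)).2 (pow_ne_zero 2 t4_ne_zero)

theorem X12_sq_ne (c : kk) : X12 ^ 2 ≠ algebraMap kk KK c :=
  algebraMap_X_pow_ne (L := KK) 0 two_ne_zero c

theorem X23_sq_ne (c : kk) : X23 ^ 2 ≠ algebraMap kk KK c :=
  algebraMap_X_pow_ne (L := KK) 1 two_ne_zero c

theorem X13_sq_ne (c : kk) : X13 ^ 2 ≠ algebraMap kk KK c :=
  algebraMap_X_pow_ne (L := KK) 2 two_ne_zero c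

theorem KK_algEquiv_ext {σ τ : KK ≃ₐ[kk] KK} (h12 : σ X12 = τ X12) (h23 : σ X23 = τ X23)
    (h13 : σ X13 = τ X13) : σ = τ := by
  have h : (σ : KK →+* KK) = (τ : KK →+* KK) := by
    apply IsLocalization.ringHom_ext (nonZeroDivisors (MvPolynomial (Fin 3) kk))
    apply MvPolynomial.ringHom_ext
    · intro c
      exact (σ.commutes c).trans (τ.commutes c).symm
    · intro i
      fin_cases i
      exacts [h12, h23, h13]
  ext f
  exact RingHom.congr_fun h f

theorem IsShift.commute {d e : KK ≃ₐ[kk] KK} {c : kk} {u v w : KK}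
    (hd : IsShift d c u v w) (he : IsShift e c v u w)
    (hext : ∀ {σ τ : KK ≃ₐ[kk] KK}, σ u = τ u → σ v = τ v → σ w = τ w → σ = τ) :
    Commute d e := by
  apply hext <;>
    simp only [AlgEquiv.mul_apply, hd.shift, hd.fix_left, hd.fix_right, he.shift, he.fix_left,
      he.fix_right, map_mul, AlgEquiv.commutes]

theorem qcomm_one (A B : Module.End kk KK) : qcomm 1 A B = qBracket q4 A B := by
  simp only [qcomm, qBracket, zpow_one]

theorem askeyCoeff_eq_div {F : Type*} [Field F] {t u v : F} (hu : u ≠ 0) (hv : v ≠ 0) (w : F) :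
    askeyCoeff t u v w = (1 - t * w * u * v) * (1 - t * w⁻¹ * u * v) /
      (t * u * v * (u - u⁻¹) * (v - v⁻¹)) := by
  rw [askeyCoeff]
  congr 1
  · ring
  · field_simp

theorem neg_twist {k F : Type*} [Field k] [Field F] [Algebra k F] (g : F) (σ : F ≃ₐ[k] F) :
    -twist g σ = twist (-g) σ := by
  ext f
  simp

theorem askeyOp_eq {k F : Type*} [Field k] [Field F] [Algebra k F] (t u v w : F)
    (du dv : F ≃ₐ[k] F) (hu : u ≠ 0) (hv : v ≠ 0) (c : ℤ → ℤ → F)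
    (hc : ∀ a b : ℤ, c a b = (1 - t * w * u ^ a * v ^ b) * (1 - t * w⁻¹ * u ^ a * v ^ b) /
      (t * u ^ a * v ^ b * (u - u⁻¹) * (v - v⁻¹))) :
    askeyOp t u v w du dv = twist (c 1 1) (du * dv) - twist (c 1 (-1)) (du * dv.symm)
      - twist (c (-1) 1) (du.symm * dv) + twist (c (-1) (-1)) (du.symm * dv.symm) := by
  have hu' := inv_ne_zero hu
  have hv' := inv_ne_zero hv
  simp only [askeyOp, sum_intUnits_eq _ (1 : ℤˣ), Units.val_one, Units.val_neg, zpow_one, zpow_neg,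
    askeyCoeff_eq_div, hu, hv, hu', hv', hc, sub_eq_add_neg, neg_twist, ne_eq, not_false_eq_true,
    inv_inv, AlgEquiv.aut_inv, ← add_assoc]
  refine congrArg₂ _ (congrArg₂ _ (congrArg₂ _ rfl ?_) ?_) ?_
  all_goals
    congr 1
    simp only [← neg_sub u, ← neg_sub v, ← sub_eq_add_neg]
    simp only [mul_neg, neg_mul, div_neg, neg_neg]

theorem X12_ne_zero : X12 ≠ 0 := fun h => X12_sq_ne 0 (by simp [h])

theorem X23_ne_zero : X23 ≠ 0 := fun h => X23_sq_ne 0 (by simp [h])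

theorem X13_ne_zero : X13 ≠ 0 := fun h => X13_sq_ne 0 (by simp [h])

theorem Ohat1_eq (δ12 δ13 : KK ≃ₐ[kk] KK) : Ohat1 δ12 δ13 = askeyOp st X12 X13 X23 δ12 δ13 :=
  (askeyOp_eq _ _ _ _ _ _ X12_ne_zero X13_ne_zero c1 fun _ _ => rfl).symm

theorem Ohat3_eq (δ12 δ23 : KK ≃ₐ[kk] KK) : Ohat3 δ12 δ23 = askeyOp st X12 X23 X13 δ12 δ23 :=
  (askeyOp_eq _ _ _ _ _ _ X12_ne_zero X23_ne_zero c3 fun _ _ => rfl).symm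

theorem Ohat5_eq (δ13 δ23 : KK ≃ₐ[kk] KK) : Ohat5 δ13 δ23 = askeyOp st X13 X23 X12 δ13 δ23 :=
  (askeyOp_eq _ _ _ _ _ _ X13_ne_zero X23_ne_zero c5 fun _ _ => rfl).symm

/-- `[[Ô₁,Ô₂]_q,Ô₃]_q = [[Ô₄,Ô₅]_q,Ô₆]_q`, `[[Ô₂,Ô₃]_q,Ô₄]_q = [[Ô₅,Ô₆]_q,Ô₁]_q`
and `[[Ô₃,Ô₄]_q,Ô₅]_q = [[Ô₆,Ô₁]_q,Ô₂]_q`. -/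
theorem triple_qcomm_identities
    (δ12 δ23 δ13 : KK ≃ₐ[kk] KK)
    (h12x : δ12 X12 = qh * X12) (h12y : δ12 X23 = X23) (h12z : δ12 X13 = X13)
    (h23x : δ23 X12 = X12) (h23y : δ23 X23 = qh * X23) (h23z : δ23 X13 = X13)
    (h13x : δ13 X12 = X12) (h13y : δ13 X23 = X23) (h13z : δ13 X13 = qh * X13) :
    qcomm 1 (qcomm 1 (Ohat1 δ12 δ13) Ohat2) (Ohat3 δ12 δ23)
      = qcomm 1 (qcomm 1 Ohat4 (Ohat5 δ13 δ23)) Ohat6 ∧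
    qcomm 1 (qcomm 1 Ohat2 (Ohat3 δ12 δ23)) Ohat4
      = qcomm 1 (qcomm 1 (Ohat5 δ13 δ23) Ohat6) (Ohat1 δ12 δ13) ∧
    qcomm 1 (qcomm 1 (Ohat3 δ12 δ23) Ohat4) (Ohat5 δ13 δ23)
      = qcomm 1 (qcomm 1 Ohat6 (Ohat1 δ12 δ13)) Ohat2 := by
  have d12 : IsShift δ12 (q4 ^ 2) X12 X23 X13 := ⟨h12x, h12y, h12z⟩
  have d12' : IsShift δ12 (q4 ^ 2) X12 X13 X23 := ⟨h12x, h12z, h12y⟩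
  have d23 : IsShift δ23 (q4 ^ 2) X23 X12 X13 := ⟨h23y, h23x, h23z⟩
  have d23' : IsShift δ23 (q4 ^ 2) X23 X13 X12 := ⟨h23y, h23z, h23x⟩
  have d13 : IsShift δ13 (q4 ^ 2) X13 X12 X23 := ⟨h13z, h13x, h13y⟩
  have d13' : IsShift δ13 (q4 ^ 2) X13 X23 X12 := ⟨h13z, h13y, h13x⟩
  have hxy : Commute δ12 δ23 := d12.commute d23 fun h h' h'' => KK_algEquiv_ext h h' h''
  have hxz : Commute δ12 δ13 := d12'.commute d13 fun h h' h'' => KK_algEquiv_ext h h'' h'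
  have hyz : Commute δ23 δ13 := d23'.commute d13' fun h h' h'' => KK_algEquiv_ext h'' h h'
  simp only [qcomm_one, Ohat1_eq, Ohat3_eq, Ohat5_eq]
  refine ⟨?_, ?_, ?_⟩
  · exact qBracket_askeyOp q4_ne_zero q4_pow_four_ne_one st_ne_zero rfl X12_sq_ne X23_sq_ne
      X13_sq_ne d12 d23 d13 hxy hxz hyz
  · rw [askeyOp_comm _ _ _ _ hxy, askeyOp_comm _ _ _ _ hxz]
    exact (qBracket_askeyOp q4_ne_zero q4_pow_four_ne_one st_ne_zero rfl X13_sq_ne X12_sq_ne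
      X23_sq_ne d13 d12' d23' hxz.symm hyz.symm hxy).symm
  · rw [askeyOp_comm _ _ _ _ hxy, askeyOp_comm _ _ _ _ hyz.symm]
    exact qBracket_askeyOp q4_ne_zero q4_pow_four_ne_one st_ne_zero rfl X23_sq_ne X13_sq_ne
      X12_sq_ne d23' d13' d12 hyz hxy.symm hxz.symm
end
end

section
/- Let 𝕀: P → P be the 𝐤_t-algebra automorphism of the polynomial ring P induced by the permutation of variables (O₁ O₂ O₃ O₄ O₅ O₆)(O₁₂ O₂₃ O₃₄ O₄₅ O₅₆ O₆₁)(O₁₂₃ O₂₃₄ O₃₄₅) (i.e., O₁↦O₂↦O₃↦O₄↦O₅↦O₆↦O₁, O₁₂↦O₂₃↦O₃₄↦O₄₅↦O₅₆↦O₆₁↦O₁₂, O₁₂₃↦O₂₃₄↦O₃₄₅↦O₁₂₃). Then 𝕀 maps the ideal I_{q=1,t} onto itself, and hence induces a 𝐤_t-algebra automorphism of 𝒜_{q=1,t} whose sixth power is the identity. -/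
noncomputable section

open MvPolynomial

/- Variable indexing of the polynomial ring in 15 variables:
`0,…,5 ↦ O₁,…,O₆`, `6,…,11 ↦ O₁₂,O₂₃,O₃₄,O₄₅,O₅₆,O₆₁`, `12,13,14 ↦ O₁₂₃,O₂₃₄,O₃₄₅`. -/

variable (R : Type) [Field R]

/-- The single-index variable `O_n`, read cyclically modulo 6. -/
def vS (n : ℕ) : MvPolynomial (Fin 15) R := X ⟨(n - 1) % 6, by omega⟩

/-- The pair variable `O_{n,n+1}`, read cyclically (so `vP 6 = O₆₁`). -/
def vP (n : ℕ) : MvPolynomial (Fin 15) R := X ⟨6 + (n - 1) % 6, by omega⟩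

/-- The triple variable `O_{n,n+1,n+2}`, with `O₄₅₆ := O₁₂₃`, `O₅₆₁ := O₂₃₄`, `O₆₁₂ := O₃₄₅`. -/
def vT (n : ℕ) : MvPolynomial (Fin 15) R := X ⟨12 + (n - 1) % 3, by omega⟩

/-- The first family of relations (`c` is `t^{1/2}+t^{-1/2}`, equal to `2` at `t = 1`):
`O_{i+2}O_{i+4} + O_{i+3}O_{i+2,i+3,i+4} − O_{i+2,i+3}O_{i+3,i+4} − c·O_i`. -/
def relA (c : R) (i : ℕ) : MvPolynomial (Fin 15) R :=
  vS R (i + 2) * vS R (i + 4) + vS R (i + 3) * vT R (i + 2)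
    - vP R (i + 2) * vP R (i + 3) - C c * vS R i

/-- The second family of relations:
`−O_{i+3}O_{i+5,i+6} − O_{i+4}O_{i+1,i+2} + O_{i+3,i+4}O_{i+1,i+2,i+3} − c·(O_{i,i+1} − O_iO_{i+1})`. -/
def relB (c : R) (i : ℕ) : MvPolynomial (Fin 15) R :=
  -(vS R (i + 3) * vP R (i + 5)) - vS R (i + 4) * vP R (i + 1)
    + vP R (i + 3) * vT R (i + 1) - C c * (vP R i - vS R i * vS R (i + 1))

/-- The third family of relations:
`−O_{i+1,i+2}O_{i+4,i+5} + O_{i,i+1,i+2}O_{i+1,i+2,i+3} − O_iO_{i+3}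
  − c·(−O_{i+2,i+3,i+4} + O_{i+1}O_{i+5,i+6} + O_{i+5}O_{i,i+1} − O_iO_{i+1}O_{i+5})`. -/
def relC (c : R) (i : ℕ) : MvPolynomial (Fin 15) R :=
  -(vP R (i + 1) * vP R (i + 4)) + vT R i * vT R (i + 1) - vS R i * vS R (i + 3)
    - C c * (-(vT R (i + 2)) + vS R (i + 1) * vP R (i + 5)
        + vS R (i + 5) * vP R i - vS R i * vS R (i + 1) * vS R (i + 5))

/-- The Casimir relation (with `c = t^{1/2}+t^{-1/2}`; at `t = 1` one has `c/2 = 1`, `c³ = 8`). -/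
def casimirRel (c : R) : MvPolynomial (Fin 15) R :=
  vT R 1 * vT R 2 * vT R 3
    - (vS R 1 * vS R 4 * vT R 3 + vS R 2 * vS R 5 * vT R 1 + vS R 3 * vS R 6 * vT R 2)
    + C (c / 2) * (vS R 1 * vS R 6 * vP R 6 + vS R 2 * vS R 1 * vP R 1
        + vS R 3 * vS R 2 * vP R 2 + vS R 4 * vS R 3 * vP R 3
        + vS R 5 * vS R 4 * vP R 4 + vS R 6 * vS R 5 * vP R 5)
    - (vS R 1 * vS R 3 * vS R 5 + vS R 2 * vS R 4 * vS R 6)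
    - C (c / 2) * (vP R 1 ^ 2 + vP R 2 ^ 2 + vP R 3 ^ 2
        + vP R 4 ^ 2 + vP R 5 ^ 2 + vP R 6 ^ 2)
    + C (c ^ 3)

/-- The 19 generators of the defining ideal. -/
def gens (c : R) : Set (MvPolynomial (Fin 15) R) :=
  {p | (∃ i : ℕ, 1 ≤ i ∧ i ≤ 6 ∧ (p = relA R c i ∨ p = relB R c i ∨ p = relC R c i))
    ∨ p = casimirRel R c}

/-- The defining ideal. -/
def Idl (c : R) : Ideal (MvPolynomial (Fin 15) R) := Ideal.span (gens R c)

/-- The field `𝐤_t = ℂ(t^{1/4})`, realized as rational functions in one variable `t^{1/4}`. -/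
abbrev kt : Type := RatFunc ℂ

/-- `t^{1/2} + t^{-1/2}` where `t^{1/4}` is the variable of `𝐤_t`. -/
def ct : kt := RatFunc.X ^ 2 + (RatFunc.X ^ 2)⁻¹

/-- The permutation `(O₁ O₂ O₃ O₄ O₅ O₆)(O₁₂ O₂₃ O₃₄ O₄₅ O₅₆ O₆₁)(O₁₂₃ O₂₃₄ O₃₄₅)`
of the 15 variables. -/
def sigmaFun : Fin 15 → Fin 15 := fun i =>
  if h : i.val < 6 then ⟨(i.val + 1) % 6, by omega⟩
  else if h' : i.val < 12 then ⟨6 + (i.val - 6 + 1) % 6, by omega⟩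
  else ⟨12 + (i.val - 12 + 1) % 3, by omega⟩

def sigmaPerm : Equiv.Perm (Fin 15) := Equiv.ofBijective sigmaFun (by decide)

/-- The induced `𝐤_t`-algebra automorphism `𝕀` of the polynomial ring. -/
def Iauto : MvPolynomial (Fin 15) kt ≃ₐ[kt] MvPolynomial (Fin 15) kt :=
  MvPolynomial.renameEquiv kt sigmaPerm

lemma coe_sigmaPerm : (sigmaPerm : Fin 15 → Fin 15) = sigmaFun := rfl

lemma sigmaPerm_iterate_six : (sigmaPerm : Fin 15 → Fin 15)^[6] = id := by
  rw [coe_sigmaPerm]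
  decide

lemma rename_sigmaPerm_vS {n : ℕ} (hn : 1 ≤ n) :
    rename sigmaPerm (vS R n) = vS R (n + 1) := by
  have h : (n - 1) % 6 < 6 := Nat.mod_lt _ (by norm_num)
  simp only [vS, rename_X, coe_sigmaPerm, sigmaFun]
  congr 1
  ext
  simp only [h, dite_true]
  omega

lemma rename_sigmaPerm_vP {n : ℕ} (hn : 1 ≤ n) :
    rename sigmaPerm (vP R n) = vP R (n + 1) := by
  simp only [vP, rename_X, coe_sigmaPerm, sigmaFun]
  congr 1
  ext
  split_ifs <;> dsimp only <;> omega

lemma rename_sigmaPerm_vT {n : ℕ} (hn : 1 ≤ n) :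
    rename sigmaPerm (vT R n) = vT R (n + 1) := by
  simp only [vT, rename_X, coe_sigmaPerm, sigmaFun]
  congr 1
  ext
  split_ifs <;> dsimp only <;> omega

lemma rename_sigmaPerm_relA (c : R) {i : ℕ} (hi : 1 ≤ i) :
    rename sigmaPerm (relA R c i) = relA R c (i + 1) := by
  simp (disch := omega) only [relA, map_add, map_sub, map_mul, rename_C, rename_sigmaPerm_vS,
    rename_sigmaPerm_vP, rename_sigmaPerm_vT, Nat.add_right_comm i 1]

lemma rename_sigmaPerm_relB (c : R) {i : ℕ} (hi : 1 ≤ i) :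
    rename sigmaPerm (relB R c i) = relB R c (i + 1) := by
  simp (disch := omega) only [relB, map_add, map_sub, map_neg, map_mul, rename_C,
    rename_sigmaPerm_vS, rename_sigmaPerm_vP, rename_sigmaPerm_vT, Nat.add_right_comm i 1]

lemma rename_sigmaPerm_relC (c : R) {i : ℕ} (hi : 1 ≤ i) :
    rename sigmaPerm (relC R c i) = relC R c (i + 1) := by
  simp (disch := omega) only [relC, map_add, map_sub, map_neg, map_mul, rename_C,
    rename_sigmaPerm_vS, rename_sigmaPerm_vP, rename_sigmaPerm_vT, Nat.add_right_comm i 1]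

lemma relA_seven (c : R) : relA R c 7 = relA R c 1 := rfl

lemma relB_seven (c : R) : relB R c 7 = relB R c 1 := rfl

lemma relC_seven (c : R) : relC R c 7 = relC R c 1 := rfl

lemma rename_sigmaPerm_casimirRel (c : R) :
    rename sigmaPerm (casimirRel R c) = casimirRel R c := by
  simp (disch := omega) only [casimirRel, map_add, map_sub, map_mul, map_pow, rename_C,
    rename_sigmaPerm_vS, rename_sigmaPerm_vP, rename_sigmaPerm_vT, Nat.reduceAdd]
  rw [show vS R 7 = vS R 1 from rfl, show vP R 7 = vP R 1 from rfl,
    show vT R 4 = vT R 1 from rfl]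
  ring

lemma rename_sigmaPerm_mem_gens (c : R) {p : MvPolynomial (Fin 15) R} (hp : p ∈ gens R c) :
    rename sigmaPerm p ∈ gens R c := by
  rcases hp with ⟨i, h1, h6, hp⟩ | rfl
  · left
    rcases h6.lt_or_eq with h6 | rfl
    · refine ⟨i + 1, by omega, h6, ?_⟩
      rcases hp with rfl | rfl | rfl
      · exact .inl (rename_sigmaPerm_relA R c h1)
      · exact .inr (.inl (rename_sigmaPerm_relB R c h1))
      · exact .inr (.inr (rename_sigmaPerm_relC R c h1))
    · refine ⟨1, le_rfl, by norm_num, ?_⟩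
      rcases hp with rfl | rfl | rfl
      · exact .inl ((rename_sigmaPerm_relA R c h1).trans (relA_seven R c))
      · exact .inr (.inl ((rename_sigmaPerm_relB R c h1).trans (relB_seven R c)))
      · exact .inr (.inr ((rename_sigmaPerm_relC R c h1).trans (relC_seven R c)))
  · exact .inr (rename_sigmaPerm_casimirRel R c)

lemma Iauto_six (p : MvPolynomial (Fin 15) kt) :
    Iauto (Iauto (Iauto (Iauto (Iauto (Iauto p))))) = p := by
  simp only [Iauto, renameEquiv_apply, rename_rename]
  exact (congrArg (fun f => rename f p) sigmaPerm_iterate_six).trans (rename_id_apply p)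

lemma Iauto_mem_gens {p : MvPolynomial (Fin 15) kt} (hp : p ∈ gens kt ct) :
    Iauto p ∈ gens kt ct :=
  rename_sigmaPerm_mem_gens kt ct hp

lemma Iauto_image_gens : Iauto '' gens kt ct = gens kt ct := by
  refine Set.Subset.antisymm (Set.image_subset_iff.2 fun p => Iauto_mem_gens) fun p hp => ?_
  exact ⟨_, Iauto_mem_gens <| Iauto_mem_gens <| Iauto_mem_gens <| Iauto_mem_gens <|
    Iauto_mem_gens hp, Iauto_six p⟩

lemma map_Iauto_Idl :
    Ideal.map (Iauto : MvPolynomial (Fin 15) kt →+* MvPolynomial (Fin 15) kt) (Idl kt ct)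
      = Idl kt ct := by
  rw [Idl, Ideal.map_span]
  exact congrArg Ideal.span Iauto_image_gens

/-- the permutation automorphism `𝕀` maps `I_{q=1,t}` onto itself, hence
descends to a `𝐤_t`-algebra automorphism of `𝒜_{q=1,t}` whose sixth power is the identity. -/
theorem Iauto_preserves_ideal :
    Ideal.map (Iauto : MvPolynomial (Fin 15) kt →+* MvPolynomial (Fin 15) kt) (Idl kt ct)
      = Idl kt ct ∧
    ∃ Ψ : (MvPolynomial (Fin 15) kt ⧸ Idl kt ct) ≃ₐ[kt] (MvPolynomial (Fin 15) kt ⧸ Idl kt ct),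
      (∀ p : MvPolynomial (Fin 15) kt,
        Ψ (Ideal.Quotient.mk (Idl kt ct) p) = Ideal.Quotient.mk (Idl kt ct) (Iauto p)) ∧
      ∀ x, Ψ (Ψ (Ψ (Ψ (Ψ (Ψ x))))) = x := by
  refine ⟨map_Iauto_Idl, Ideal.quotientEquivAlg _ _ Iauto map_Iauto_Idl.symm, fun p => rfl,
    fun x => ?_⟩
  obtain ⟨p, rfl⟩ := Ideal.Quotient.mk_surjective x
  exact congrArg (Ideal.Quotient.mk (Idl kt ct)) (Iauto_six p)
end
end

section
/- Let d₁: P → P be the 𝐤_t-algebra endomorphism determined on the variables by d₁(O₂)=O₁O₂−O₁₂, d₁(O₆)=O₆₁, d₁(O₁₂)=O₂, d₁(O₂₃)=O₁O₂₃−O₁₂₃, d₁(O₅₆)=O₂₃₄, d₁(O₆₁)=O₁O₆₁−O₆, d₁(O₁₂₃)=O₂₃, d₁(O₂₃₄)=O₁O₂₃₄−O₅₆, and d₁ fixes the remaining variables O₁,O₃,O₄,O₅,O₃₄,O₄₅,O₃₄₅. Then d₁ is bijective, with inverse the 𝐤_t-algebra endomorphism determined by O₂↦O₁₂, O₆↦O₁O₆−O₆₁,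 O₁₂↦O₁O₁₂−O₂, O₂₃↦O₁₂₃, O₅₆↦O₁O₅₆−O₂₃₄, O₆₁↦O₆, O₁₂₃↦O₁O₁₂₃−O₂₃, O₂₃₄↦O₅₆ (fixing the remaining variables); moreover d₁ maps the ideal I_{q=1,t} into itself, and hence induces a 𝐤_t-algebra automorphism of 𝒜_{q=1,t}. -/
noncomputable section

open MvPolynomial

/- Variable indexing of the polynomial ring in 15 variables:
`0,…,5 ↦ O₁,…,O₆`, `6,…,11 ↦ O₁₂,O₂₃,O₃₄,O₄₅,O₅₆,O₆₁`, `12,13,14 ↦ O₁₂₃,O₂₃₄,O₃₄₅`. -/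

variable (R : Type) [Field R]

/-- Images of the 15 variables under `d₁`:
`O₂↦O₁O₂−O₁₂`, `O₆↦O₆₁`, `O₁₂↦O₂`, `O₂₃↦O₁O₂₃−O₁₂₃`, `O₅₆↦O₂₃₄`, `O₆₁↦O₁O₆₁−O₆`,
`O₁₂₃↦O₂₃`, `O₂₃₄↦O₁O₂₃₄−O₅₆`, fixing the other variables. -/
def d1imgs : Fin 15 → MvPolynomial (Fin 15) kt :=
  ![X 0, X 0 * X 1 - X 6, X 2, X 3, X 4, X 11,
    X 1, X 0 * X 7 - X 12, X 8, X 9, X 13, X 0 * X 11 - X 5,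
    X 7, X 0 * X 13 - X 10, X 14]

/-- Images of the 15 variables under `d₁⁻¹`:
`O₂↦O₁₂`, `O₆↦O₁O₆−O₆₁`, `O₁₂↦O₁O₁₂−O₂`, `O₂₃↦O₁₂₃`, `O₅₆↦O₁O₅₆−O₂₃₄`, `O₆₁↦O₆`,
`O₁₂₃↦O₁O₁₂₃−O₂₃`, `O₂₃₄↦O₅₆`, fixing the other variables. -/
def d1invImgs : Fin 15 → MvPolynomial (Fin 15) kt :=
  ![X 0, X 6, X 2, X 3, X 4, X 0 * X 5 - X 11,
    X 0 * X 6 - X 1, X 12, X 8, X 9, X 0 * X 10 - X 13, X 5,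
    X 0 * X 12 - X 7, X 10, X 14]

/-- The `𝐤_t`-algebra endomorphism `d₁` of the polynomial ring. -/
def d1hom : MvPolynomial (Fin 15) kt →ₐ[kt] MvPolynomial (Fin 15) kt := aeval d1imgs

/-- The `𝐤_t`-algebra endomorphism `d₁⁻¹` of the polynomial ring. -/
def d1invHom : MvPolynomial (Fin 15) kt →ₐ[kt] MvPolynomial (Fin 15) kt := aeval d1invImgs

theorem relA_mem_Idl (c : R) {i : ℕ} (h1 : 1 ≤ i) (h6 : i ≤ 6) : relA R c i ∈ Idl R c :=
  Ideal.subset_span (Or.inl ⟨i, h1, h6, Or.inl rfl⟩)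

theorem relB_mem_Idl (c : R) {i : ℕ} (h1 : 1 ≤ i) (h6 : i ≤ 6) : relB R c i ∈ Idl R c :=
  Ideal.subset_span (Or.inl ⟨i, h1, h6, Or.inr (Or.inl rfl)⟩)

theorem relC_mem_Idl (c : R) {i : ℕ} (h1 : 1 ≤ i) (h6 : i ≤ 6) : relC R c i ∈ Idl R c :=
  Ideal.subset_span (Or.inl ⟨i, h1, h6, Or.inr (Or.inr rfl)⟩)

theorem casimirRel_mem_Idl (c : R) : casimirRel R c ∈ Idl R c :=
  Ideal.subset_span (Or.inr rfl)

/-- An ideal of a Noetherian ring that is contained in its preimage under a ring automorphism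
is equal to that preimage. -/
theorem Ideal.comap_eq_of_le_comap {A : Type*} [CommRing A] [IsNoetherianRing A]
    (e : A ≃+* A) {I : Ideal A} (h : I ≤ I.comap (e : A →+* A)) :
    I.comap (e : A →+* A) = I := by
  have hmono : Monotone (Ideal.comap (e : A →+* A)) := fun _ _ h => Ideal.comap_mono h
  have hinj : Function.Injective (Ideal.comap (e : A →+* A)) :=
    Ideal.comap_injective_of_surjective _ e.surjective
  obtain ⟨n, hn⟩ := monotone_stabilizes_iff_noetherian.mpr ‹IsNoetherianRing A›
    ⟨fun n => (Ideal.comap (e : A →+* A))^[n] I, hmono.monotone_iterate_of_le_map h⟩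
  have := hn (n + 1) n.le_succ
  exact (hinj.iterate n (by simpa [Function.iterate_succ_apply] using this)).symm

theorem d1invHom_d1hom (p : MvPolynomial (Fin 15) kt) : d1invHom (d1hom p) = p := by
  have : d1invHom.comp d1hom = AlgHom.id kt _ := by
    ext i : 1
    fin_cases i <;> simp [d1hom, d1invHom, d1imgs, d1invImgs]
  exact DFunLike.congr_fun this p

theorem d1hom_d1invHom (p : MvPolynomial (Fin 15) kt) : d1hom (d1invHom p) = p := by
  have : d1hom.comp d1invHom = AlgHom.id kt _ := by
    ext i : 1
    fin_cases i <;> simp [d1hom, d1invHom, d1imgs, d1invImgs]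
  exact DFunLike.congr_fun this p

/-- `d₁` as an automorphism of the polynomial ring. -/
def d1Equiv : MvPolynomial (Fin 15) kt ≃ₐ[kt] MvPolynomial (Fin 15) kt :=
  AlgEquiv.ofAlgHom d1hom d1invHom (AlgHom.ext d1hom_d1invHom) (AlgHom.ext d1invHom_d1hom)

theorem d1hom_relA_mem (c : kt) {i : ℕ} (h1 : 1 ≤ i) (h6 : i ≤ 6) :
    d1hom (relA kt c i) ∈ Idl kt c := by
  have hA1 := relA_mem_Idl kt c (i := 1) (by norm_num) (by norm_num)
  have hA3 := relA_mem_Idl kt c (i := 3) (by norm_num) (by norm_num)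
  have hA4 := relA_mem_Idl kt c (i := 4) (by norm_num) (by norm_num)
  have hA5 := relA_mem_Idl kt c (i := 5) (by norm_num) (by norm_num)
  have hA6 := relA_mem_Idl kt c (i := 6) (by norm_num) (by norm_num)
  have hB1 := relB_mem_Idl kt c (i := 1) (by norm_num) (by norm_num)
  have hB6 := relB_mem_Idl kt c (i := 6) (by norm_num) (by norm_num)
  interval_cases i
  · have key : d1hom (relA kt c 1) = relA kt c 1 := by
      simp [d1hom, d1imgs, relA, vS, vP, vT, -algebraMap_smul]
    rw [key]
    exact hA1
  · have key : d1hom (relA kt c 2) = -relB kt c 1 := by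
      simp [d1hom, d1imgs, relA, relB, vS, vP, vT, -algebraMap_smul]
      ring
    rw [key]
    exact neg_mem hB1
  · have key : d1hom (relA kt c 3) = relA kt c 3 := by
      simp [d1hom, d1imgs, relA, vS, vP, vT, -algebraMap_smul]
      ring
    rw [key]
    exact hA3
  · have key : d1hom (relA kt c 4) = relA kt c 4 := by
      simp [d1hom, d1imgs, relA, vS, vP, vT, -algebraMap_smul]
      ring
    rw [key]
    exact hA4
  · have key : d1hom (relA kt c 5) = relA kt c 5 := by
      simp [d1hom, d1imgs, relA, vS, vP, vT, -algebraMap_smul]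
      ring
    rw [key]
    exact hA5
  · have key : d1hom (relA kt c 6) = X 0 * relA kt c 6 + relB kt c 6 := by
      simp [d1hom, d1imgs, relA, relB, vS, vP, vT, -algebraMap_smul]
      ring
    rw [key]
    exact add_mem (Ideal.mul_mem_left _ _ hA6) hB6

theorem d1hom_relB_mem (c : kt) {i : ℕ} (h1 : 1 ≤ i) (h6 : i ≤ 6) :
    d1hom (relB kt c i) ∈ Idl kt c := by
  have hA2 := relA_mem_Idl kt c (i := 2) (by norm_num) (by norm_num)
  have hA4 := relA_mem_Idl kt c (i := 4) (by norm_num) (by norm_num)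
  have hA5 := relA_mem_Idl kt c (i := 5) (by norm_num) (by norm_num)
  have hA6 := relA_mem_Idl kt c (i := 6) (by norm_num) (by norm_num)
  have hB1 := relB_mem_Idl kt c (i := 1) (by norm_num) (by norm_num)
  have hB3 := relB_mem_Idl kt c (i := 3) (by norm_num) (by norm_num)
  have hB4 := relB_mem_Idl kt c (i := 4) (by norm_num) (by norm_num)
  have hC2 := relC_mem_Idl kt c (i := 2) (by norm_num) (by norm_num)
  have hC3 := relC_mem_Idl kt c (i := 3) (by norm_num) (by norm_num)
  interval_cases i
  · have key : d1hom (relB kt c 1) = X 0 * relB kt c 1 + relA kt c 2 := by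
      simp [d1hom, d1imgs, relA, relB, vS, vP, vT, -algebraMap_smul]
      ring
    rw [key]
    exact add_mem (Ideal.mul_mem_left _ _ hB1) hA2
  · have key : d1hom (relB kt c 2) = relC kt c 2 := by
      simp [d1hom, d1imgs, relB, relC, vS, vP, vT, -algebraMap_smul]
      ring
    rw [key]
    exact hC2
  · have key : d1hom (relB kt c 3) = relB kt c 3 := by
      simp [d1hom, d1imgs, relB, vS, vP, vT, -algebraMap_smul]
      ring
    rw [key]
    exact hB3
  · have key : d1hom (relB kt c 4) = relB kt c 4 := by
      simp [d1hom, d1imgs, relB, vS, vP, vT, -algebraMap_smul]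
      ring
    rw [key]
    exact hB4
  · have key : d1hom (relB kt c 5) =
        X 7 * relA kt c 4 - X 11 * relA kt c 5 + X 1 * relB kt c 3 - relC kt c 3 := by
      simp [d1hom, d1imgs, relA, relB, relC, vS, vP, vT, -algebraMap_smul]
      ring
    rw [key]
    exact sub_mem (add_mem (sub_mem (Ideal.mul_mem_left _ _ hA4) (Ideal.mul_mem_left _ _ hA5))
      (Ideal.mul_mem_left _ _ hB3)) hC3
  · have key : d1hom (relB kt c 6) = -relA kt c 6 := by
      simp [d1hom, d1imgs, relA, relB, vS, vP, vT, -algebraMap_smul]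
      ring
    rw [key]
    exact neg_mem hA6

theorem d1hom_relC_mem (c : kt) {i : ℕ} (h1 : 1 ≤ i) (h6 : i ≤ 6) :
    d1hom (relC kt c i) ∈ Idl kt c := by
  have hA1 := relA_mem_Idl kt c (i := 1) (by norm_num) (by norm_num)
  have hA3 := relA_mem_Idl kt c (i := 3) (by norm_num) (by norm_num)
  have hA4 := relA_mem_Idl kt c (i := 4) (by norm_num) (by norm_num)
  have hA6 := relA_mem_Idl kt c (i := 6) (by norm_num) (by norm_num)
  have hB1 := relB_mem_Idl kt c (i := 1) (by norm_num) (by norm_num)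
  have hB2 := relB_mem_Idl kt c (i := 2) (by norm_num) (by norm_num)
  have hB4 := relB_mem_Idl kt c (i := 4) (by norm_num) (by norm_num)
  have hB5 := relB_mem_Idl kt c (i := 5) (by norm_num) (by norm_num)
  have hC1 := relC_mem_Idl kt c (i := 1) (by norm_num) (by norm_num)
  have hC2 := relC_mem_Idl kt c (i := 2) (by norm_num) (by norm_num)
  have hC4 := relC_mem_Idl kt c (i := 4) (by norm_num) (by norm_num)
  interval_cases i
  · have key : d1hom (relC kt c 1) = relC kt c 1 := by
      simp [d1hom, d1imgs, relC, vS, vP, vT, -algebraMap_smul]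
      ring
    rw [key]
    exact hC1
  · have key : d1hom (relC kt c 2) = X 0 * relC kt c 2 - relB kt c 2 := by
      simp [d1hom, d1imgs, relB, relC, vS, vP, vT, -algebraMap_smul]
      ring
    rw [key]
    exact sub_mem (Ideal.mul_mem_left _ _ hC2) hB2
  · have key : d1hom (relC kt c 3) =
        X 3 * relC kt c 2 - X 8 * relB kt c 1 - X 13 * relA kt c 1 + X 4 * relA kt c 6
        + relB kt c 5 := by
      simp [d1hom, d1imgs, relA, relB, relC, vS, vP, vT, -algebraMap_smul]
      ring
    rw [key]
    exact add_mem (add_mem (sub_mem (sub_mem (Ideal.mul_mem_left _ _ hC2)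
      (Ideal.mul_mem_left _ _ hB1)) (Ideal.mul_mem_left _ _ hA1)) (Ideal.mul_mem_left _ _ hA6)) hB5
  · have key : d1hom (relC kt c 4) = relC kt c 4 := by
      simp [d1hom, d1imgs, relC, vS, vP, vT, -algebraMap_smul]
      ring
    rw [key]
    exact hC4
  · have key : d1hom (relC kt c 5) =
        X 11 * relB kt c 4 + X 13 * relA kt c 4 - X 1 * relA kt c 3 - relB kt c 2 := by
      simp [d1hom, d1imgs, relA, relB, relC, vS, vP, vT, -algebraMap_smul]
      ring
    rw [key]
    exact sub_mem (sub_mem (add_mem (Ideal.mul_mem_left _ _ hB4) (Ideal.mul_mem_left _ _ hA4))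
      (Ideal.mul_mem_left _ _ hA3)) hB2
  · have key : d1hom (relC kt c 6) = relB kt c 5 := by
      simp [d1hom, d1imgs, relB, relC, vS, vP, vT, -algebraMap_smul]
      ring
    rw [key]
    exact hB5

/-- Twice the image of the Casimir relation, as a combination of the relations. -/
theorem two_mul_d1hom_casimirRel (c : kt) :
    2 * d1hom (casimirRel kt c) = 2 * casimirRel kt c +
      ((X 0 * X 7 - X 12) * relC kt c 2 + (X 0 * X 1 - X 6) * relB kt c 1
        - X 11 * X 13 * relA kt c 5 + X 7 * X 13 * relA kt c 4 + X 1 * X 13 * relB kt c 3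
        - X 13 * relC kt c 3 + (X 5 - X 0 * X 11) * relA kt c 6 - X 11 * relB kt c 6
        - X 10 * relB kt c 5 - X 7 * relB kt c 2 + X 1 * relA kt c 2) := by
  have hc : (C c : MvPolynomial (Fin 15) kt) = 2 * C (c / 2) := by
    rw [← map_ofNat C 2, ← C_mul, mul_div_cancel₀ _ two_ne_zero]
  have hd : d1hom (C (c / 2)) = C (c / 2) := d1hom.commutes _
  simp only [casimirRel, hc, map_add, map_sub, map_mul, map_pow, map_ofNat, hd, relA, relB, relC]
  simp only [d1hom, d1imgs, vS, vP, vT, aeval_X]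
  simp only [Nat.reduceAdd, Nat.reduceSub, Nat.reduceMod, Fin.reduceFinMk, Matrix.cons_val]
  ring

theorem d1hom_casimirRel_mem (c : kt) : d1hom (casimirRel kt c) ∈ Idl kt c := by
  have h2 : C (1 / 2 : kt) * (2 : MvPolynomial (Fin 15) kt) = 1 := by
    rw [← map_ofNat C 2, ← C_mul, one_div_mul_cancel two_ne_zero, C_1]
  have hA (i : ℕ) (p) (h : 1 ≤ i ∧ i ≤ 6) : p * relA kt c i ∈ Idl kt c :=
    Ideal.mul_mem_left _ p (relA_mem_Idl kt c h.1 h.2)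
  have hB (i : ℕ) (p) (h : 1 ≤ i ∧ i ≤ 6) : p * relB kt c i ∈ Idl kt c :=
    Ideal.mul_mem_left _ p (relB_mem_Idl kt c h.1 h.2)
  have hC (i : ℕ) (p) (h : 1 ≤ i ∧ i ≤ 6) : p * relC kt c i ∈ Idl kt c :=
    Ideal.mul_mem_left _ p (relC_mem_Idl kt c h.1 h.2)
  rw [← one_mul (d1hom _), ← h2, mul_assoc, two_mul_d1hom_casimirRel]
  refine Ideal.mul_mem_left _ _
    (add_mem (Ideal.mul_mem_left _ _ (casimirRel_mem_Idl kt c)) ?_)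
  refine add_mem (sub_mem (sub_mem (sub_mem (add_mem (sub_mem (add_mem (add_mem (sub_mem (add_mem
    (hC 2 _ ?_) (hB 1 _ ?_)) (hA 5 _ ?_)) (hA 4 _ ?_)) (hB 3 _ ?_)) (hC 3 _ ?_)) (hA 6 _ ?_))
    (hB 6 _ ?_)) (hB 5 _ ?_)) (hB 2 _ ?_)) (hA 2 _ ?_) <;> norm_num

/-- `d₁` maps the defining ideal into itself. -/
theorem Idl_le_comap_d1hom (c : kt) : Idl kt c ≤ (Idl kt c).comap d1hom := by
  refine Ideal.span_le.mpr ?_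
  rintro _ (⟨i, h1, h6, rfl | rfl | rfl⟩ | rfl)
  exacts [d1hom_relA_mem c h1 h6, d1hom_relB_mem c h1 h6, d1hom_relC_mem c h1 h6,
    d1hom_casimirRel_mem c]

theorem map_d1Equiv_Idl (c : kt) :
    Idl kt c = (Idl kt c).map (d1Equiv : MvPolynomial (Fin 15) kt →+* MvPolynomial (Fin 15) kt) := by
  have h := Ideal.comap_eq_of_le_comap d1Equiv.toRingEquiv (Idl_le_comap_d1hom c)
  conv_rhs => rw [← h]
  exact (Ideal.map_comap_of_surjective _ d1Equiv.surjective _).symm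

/-- `d₁` is bijective with inverse `d₁⁻¹`, it maps the ideal `I_{q=1,t}` into
itself, and hence induces a `𝐤_t`-algebra automorphism of `𝒜_{q=1,t}`. -/
theorem d1_automorphism :
    Function.Bijective d1hom ∧
    (∀ p, d1invHom (d1hom p) = p) ∧
    (∀ p, d1hom (d1invHom p) = p) ∧
    (∀ p ∈ Idl kt ct, d1hom p ∈ Idl kt ct) ∧
    ∃ Ψ : (MvPolynomial (Fin 15) kt ⧸ Idl kt ct) ≃ₐ[kt] (MvPolynomial (Fin 15) kt ⧸ Idl kt ct),
      ∀ p : MvPolynomial (Fin 15) kt,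
        Ψ (Ideal.Quotient.mk (Idl kt ct) p) = Ideal.Quotient.mk (Idl kt ct) (d1hom p) := by
  exact ⟨d1Equiv.bijective, d1invHom_d1hom, d1hom_d1invHom, Idl_le_comap_d1hom ct,
    Ideal.quotientEquivAlg (Idl kt ct) (Idl kt ct) d1Equiv (map_d1Equiv_Idl ct), fun _ => rfl⟩
end
end

section
/- Let G be the group presented by generators d₁,…,d₅ and relations d_i d_{i+1} d_i = d_{i+1} d_i d_{i+1} for 1 ≤ i ≤ 4, d_i d_j = d_j d_i whenever |i−j| > 1, I⁶ = 1 and H² = 1, where I = d₁d₂d₃d₄d₅ and H = d₁d₂d₃d₄d₅d₅d₄d₃d₂d₁ (the Birman–Hilden presentation of the mapping class group Mod(Σ₂) of a closed genus-two surface). Let D₁ denote the 𝐤_t-algebra automorphism of 𝒜_{q=1,t} induced by the substitution O₂↦O₁O₂−O₁₂, O₆↦O₆₁, O₁₂↦O₂, O₂₃↦O₁O₂₃−O₁₂₃, O₅₆↦O₂₃₄, O₆₁↦O₁O₆₁−O₆, O₁₂₃↦O₂₃, O₂₃₄↦O₁O₂₃₄−O₅₆ (fixing the remaining generators), and let 𝕁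 denote the 𝐤_t-algebra automorphism of 𝒜_{q=1,t} induced by the permutation of generators (O₁ O₂ O₃ O₄ O₅ O₆)(O₁₂ O₂₃ O₃₄ O₄₅ O₅₆ O₆₁)(O₁₂₃ O₂₃₄ O₃₄₅). Then there is a group homomorphism φ: G → Aut_{𝐤_t}(𝒜_{q=1,t}) with φ(d_i) = 𝕁^{i−1}∘D₁∘𝕁^{1−i} for 1 ≤ i ≤ 5; moreover φ(d₁d₂d₃d₄d₅) = 𝕁 and φ(H) = id. -/
noncomputable section

open MvPolynomial

/- Variable indexing of the polynomial ring in 15 variables: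
`0,…,5 ↦ O₁,…,O₆`, `6,…,11 ↦ O₁₂,O₂₃,O₃₄,O₄₅,O₅₆,O₆₁`, `12,13,14 ↦ O₁₂₃,O₂₃₄,O₃₄₅`. -/

variable (R : Type) [Field R]

/-- The quotient algebra `𝒜_{q=1,t}`. -/
abbrev Aq1t : Type := MvPolynomial (Fin 15) kt ⧸ Idl kt ct

/-- Generators `d₁,…,d₅` of the free group (0-indexed). -/
def dgen (i : Fin 5) : FreeGroup (Fin 5) := FreeGroup.of i

/-- Braid relator `d_i d_{i+1} d_i (d_{i+1} d_i d_{i+1})⁻¹`. -/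
def braidRel (i : Fin 4) : FreeGroup (Fin 5) :=
  dgen i.castSucc * dgen i.succ * dgen i.castSucc *
    (dgen i.succ * dgen i.castSucc * dgen i.succ)⁻¹

/-- Commutation relator `d_i d_j d_i⁻¹ d_j⁻¹`. -/
def commRel (i j : Fin 5) : FreeGroup (Fin 5) :=
  dgen i * dgen j * (dgen i)⁻¹ * (dgen j)⁻¹

/-- The word `I = d₁d₂d₃d₄d₅`. -/
def Iword : FreeGroup (Fin 5) := dgen 0 * dgen 1 * dgen 2 * dgen 3 * dgen 4

/-- The word `H = d₁d₂d₃d₄d₅d₅d₄d₃d₂d₁`. -/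
def Hword : FreeGroup (Fin 5) := Iword * dgen 4 * dgen 3 * dgen 2 * dgen 1 * dgen 0

/-- The Birman–Hilden relators of `Mod(Σ₂)`. -/
def mcgRels : Set (FreeGroup (Fin 5)) :=
  {r | (∃ i : Fin 4, r = braidRel i) ∨
    (∃ i j : Fin 5, (i : ℕ) + 1 < (j : ℕ) ∧ r = commRel i j) ∨
    r = Iword ^ 6 ∨ r = Hword ^ 2}

/-- The mapping class group of a closed genus two surface (Birman–Hilden presentation). -/
abbrev MCG : Type := PresentedGroup mcgRels

/-- Elements `D`, `J` of a group define a homomorphism from `Mod(Σ₂)` by `d_i ↦ J^{i-1} D J^{1-i}`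
as soon as they satisfy the following relations. -/
theorem exists_MCG_hom {G : Type*} [Group G] (D J : G) (hJ : J ^ 6 = 1)
    (hbraid : D * (J * D * J⁻¹) * D = J * D * J⁻¹ * D * (J * D * J⁻¹))
    (hcomm₂ : Commute D (J ^ 2 * D * (J ^ 2)⁻¹))
    (hcomm₃ : Commute D (J ^ 3 * D * (J ^ 3)⁻¹))
    (hDJ : (D * J) ^ 5 = 1) (hJD : (J⁻¹ * D) ^ 5 = 1) :
    ∃ φ : MCG →* G,
      (∀ i : Fin 5, φ (PresentedGroup.of i) = J ^ (i : ℕ) * D * (J ^ (i : ℕ))⁻¹) ∧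
      φ (PresentedGroup.of 0 * PresentedGroup.of 1 * PresentedGroup.of 2 *
          PresentedGroup.of 3 * PresentedGroup.of 4) = J ∧
      φ (PresentedGroup.of 0 * PresentedGroup.of 1 * PresentedGroup.of 2 *
          PresentedGroup.of 3 * PresentedGroup.of 4 * PresentedGroup.of 4 *
          PresentedGroup.of 3 * PresentedGroup.of 2 * PresentedGroup.of 1 *
          PresentedGroup.of 0) = 1 := by
  set d : Fin 5 → G := fun i => J ^ (i : ℕ) * D * (J ^ (i : ℕ))⁻¹ with hd
  have hconj (n m : ℕ) : J ^ (n + m) * D * (J ^ (n + m))⁻¹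
      = MulAut.conj (J ^ n) (J ^ m * D * (J ^ m)⁻¹) := by
    simp only [MulAut.conj_apply, pow_add]; group
  have hI : d 0 * d 1 * d 2 * d 3 * d 4 = J := by
    have h : d 0 * d 1 * d 2 * d 3 * d 4 = (D * J) ^ 5 * J * (J ^ 6)⁻¹ := by
      simp only [hd, pow_succ (D * J), pow_zero, one_mul, Fin.isValue,
        Fin.val_zero, Fin.val_one, Fin.val_two, show ((3 : Fin 5) : ℕ) = 3 from rfl,
        show ((4 : Fin 5) : ℕ) = 4 from rfl]
      group
    rw [h, hDJ, hJ]; simp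
  have hH : d 0 * d 1 * d 2 * d 3 * d 4 * d 4 * d 3 * d 2 * d 1 * d 0 = 1 := by
    have h : J * d 4 * d 3 * d 2 * d 1 * d 0 = J ^ 6 * (J⁻¹ * D) ^ 5 := by
      simp only [hd, pow_succ (J⁻¹ * D), pow_zero, one_mul, Fin.isValue,
        Fin.val_zero, Fin.val_one, Fin.val_two, show ((3 : Fin 5) : ℕ) = 3 from rfl,
        show ((4 : Fin 5) : ℕ) = 4 from rfl]
      group
    rw [hI, h, hJ, hJD, one_mul]
  have hrels : ∀ r ∈ mcgRels, FreeGroup.lift d r = 1 := by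
    rintro r (⟨i, rfl⟩ | ⟨i, j, hij, rfl⟩ | rfl | rfl)
    · have hsucc : d i.succ = MulAut.conj (J ^ (i : ℕ)) (J * D * J⁻¹) := by
        simpa [hd] using hconj i 1
      have hcast : d i.castSucc = MulAut.conj (J ^ (i : ℕ)) D := by
        simpa [hd] using hconj i 0
      simp only [braidRel, dgen, map_mul, map_inv, FreeGroup.lift_apply_of, hsucc, hcast]
      rw [mul_inv_eq_one]
      simpa only [map_mul, map_inv] using congrArg (MulAut.conj (J ^ (i : ℕ))) hbraid
    · simp only [commRel, dgen, map_mul, map_inv, FreeGroup.lift_apply_of]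
      rw [mul_inv_eq_one, mul_inv_eq_iff_eq_mul]
      change Commute (d i) (d j)
      obtain ⟨m, hm⟩ : ∃ m, (j : ℕ) = i + m := ⟨j - i, by omega⟩
      have hi : d i = MulAut.conj (J ^ (i : ℕ)) D := by simpa [hd] using hconj i 0
      have hj : d j = MulAut.conj (J ^ (i : ℕ)) (J ^ m * D * (J ^ m)⁻¹) := by
        simp only [hd, hm]; exact hconj i m
      rw [hi, hj]
      refine Commute.map ?_ (MulAut.conj (J ^ (i : ℕ)))
      have hm4 : m = 2 ∨ m = 3 ∨ m = 4 := by omega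
      rcases hm4 with rfl | rfl | rfl
      · exact hcomm₂
      · exact hcomm₃
      · have h := hcomm₂.symm.map (MulAut.conj (J ^ 4))
        have h6 : MulAut.conj (J ^ 4) (J ^ 2 * D * (J ^ 2)⁻¹) = D := by
          rw [← hconj 4 2, hJ]; simp
        rwa [h6, MulAut.conj_apply] at h
    · simp [Iword, dgen, hI, hJ]
    · simp [Hword, Iword, dgen, hH]
  refine ⟨PresentedGroup.toGroup hrels, fun i => PresentedGroup.toGroup.of hrels, ?_, ?_⟩
  · simpa only [map_mul, PresentedGroup.toGroup.of] using hI
  · simpa only [map_mul, PresentedGroup.toGroup.of] using hH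

section GeneratorActions

variable {A : Type*} [CommRing A] [Algebra kt A] {o : Fin 15 → A} {D J : A ≃ₐ[kt] A}

theorem d1_apply_generators (hD : ∀ i, D (o i) = aeval o (d1imgs i)) :
    D (o 0) = o 0 ∧ D (o 1) = o 0 * o 1 - o 6 ∧ D (o 2) = o 2 ∧ D (o 3) = o 3 ∧ D (o 4) = o 4 ∧
    D (o 5) = o 11 ∧ D (o 6) = o 1 ∧ D (o 7) = o 0 * o 7 - o 12 ∧ D (o 8) = o 8 ∧
    D (o 9) = o 9 ∧ D (o 10) = o 13 ∧ D (o 11) = o 0 * o 11 - o 5 ∧ D (o 12) = o 7 ∧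
    D (o 13) = o 0 * o 13 - o 10 ∧ D (o 14) = o 14 := by
  refine ⟨?_, ?_, ?_, ?_, ?_, ?_, ?_, ?_, ?_, ?_, ?_, ?_, ?_, ?_, ?_⟩ <;>
    rw [hD] <;> simp [d1imgs]

theorem sigma_apply_generators (hJ : ∀ i, J (o i) = o (sigmaPerm i)) :
    J (o 0) = o 1 ∧ J (o 1) = o 2 ∧ J (o 2) = o 3 ∧ J (o 3) = o 4 ∧ J (o 4) = o 5 ∧
    J (o 5) = o 0 ∧ J (o 6) = o 7 ∧ J (o 7) = o 8 ∧ J (o 8) = o 9 ∧ J (o 9) = o 10 ∧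
    J (o 10) = o 11 ∧ J (o 11) = o 6 ∧ J (o 12) = o 13 ∧ J (o 13) = o 14 ∧ J (o 14) = o 12 := by
  refine ⟨?_, ?_, ?_, ?_, ?_, ?_, ?_, ?_, ?_, ?_, ?_, ?_, ?_, ?_, ?_⟩ <;> exact hJ _

theorem sigma_symm_apply_generators (hJ : ∀ i, J (o i) = o (sigmaPerm i)) :
    J.symm (o 1) = o 0 ∧ J.symm (o 2) = o 1 ∧ J.symm (o 3) = o 2 ∧ J.symm (o 4) = o 3 ∧
    J.symm (o 5) = o 4 ∧ J.symm (o 0) = o 5 ∧ J.symm (o 7) = o 6 ∧ J.symm (o 8) = o 7 ∧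
    J.symm (o 9) = o 8 ∧ J.symm (o 10) = o 9 ∧ J.symm (o 11) = o 10 ∧ J.symm (o 6) = o 11 ∧
    J.symm (o 13) = o 12 ∧ J.symm (o 14) = o 13 ∧ J.symm (o 12) = o 14 := by
  have h (i : Fin 15) : J.symm (o (sigmaPerm i)) = o i := J.symm_apply_eq.2 (hJ i).symm
  exact ⟨h 0, h 1, h 2, h 3, h 4, h 5, h 6, h 7, h 8, h 9, h 10, h 11, h 12, h 13, h 14⟩

theorem sigma_pow_six (hJ : ∀ i, J (o i) = o (sigmaPerm i)) (i : Fin 15) :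
    (J ^ 6) (o i) = o i := by
  have hJt := sigma_apply_generators hJ
  fin_cases i <;> simp [pow_succ, hJt]

theorem d1_braid (hD : ∀ i, D (o i) = aeval o (d1imgs i))
    (hJ : ∀ i, J (o i) = o (sigmaPerm i)) (i : Fin 15) :
    (D * (J * D * J⁻¹) * D) (o i) = (J * D * J⁻¹ * D * (J * D * J⁻¹)) (o i) := by
  have hDt := d1_apply_generators hD
  have hJt := sigma_apply_generators hJ
  have hJsymm := sigma_symm_apply_generators hJ
  fin_cases i <;> simp [hDt, hJt, hJsymm] <;> try ring

theorem d1_comm_two (hD : ∀ i, D (o i) = aeval o (d1imgs i))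
    (hJ : ∀ i, J (o i) = o (sigmaPerm i)) (i : Fin 15) :
    (D * (J ^ 2 * D * (J ^ 2)⁻¹)) (o i) = (J ^ 2 * D * (J ^ 2)⁻¹ * D) (o i) := by
  have hDt := d1_apply_generators hD
  have hJt := sigma_apply_generators hJ
  have hJsymm := sigma_symm_apply_generators hJ
  fin_cases i <;> simp [pow_succ, hDt, hJt, hJsymm]
  ring

theorem d1_comm_three (hD : ∀ i, D (o i) = aeval o (d1imgs i))
    (hJ : ∀ i, J (o i) = o (sigmaPerm i)) (i : Fin 15) :
    (D * (J ^ 3 * D * (J ^ 3)⁻¹)) (o i) = (J ^ 3 * D * (J ^ 3)⁻¹ * D) (o i) := by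
  have hDt := d1_apply_generators hD
  have hJt := sigma_apply_generators hJ
  have hJsymm := sigma_symm_apply_generators hJ
  fin_cases i <;> simp [pow_succ, hDt, hJt, hJsymm]
  ring

theorem sigma_inv_mul_d1_pow_five (hD : ∀ i, D (o i) = aeval o (d1imgs i))
    (hJ : ∀ i, J (o i) = o (sigmaPerm i)) (i : Fin 15) :
    ((J⁻¹ * D) ^ 5) (o i) = o i := by
  have hDt := d1_apply_generators hD
  have hJsymm := sigma_symm_apply_generators hJ
  fin_cases i <;> simp [pow_succ, hDt, hJsymm] <;> try ring

/-- Ten of the generators are permuted by `D * J` in two cycles of length five; the relation for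
`c·O₆` and the action of `D * J` then determine the other five. -/
theorem d1_mul_sigma_pow_five (hD : ∀ i, D (o i) = aeval o (d1imgs i))
    (hJ : ∀ i, J (o i) = o (sigmaPerm i))
    {c : kt} (hc : c ≠ 0) (hrel : c • o 5 = o 1 * o 3 + o 2 * o 13 - o 7 * o 8) (i : Fin 15) :
    ((D * J) ^ 5) (o i) = o i := by
  have hDt := d1_apply_generators hD
  have hJt := sigma_apply_generators hJ
  set f := (D * J) ^ 5 with hf
  have hcycle : f (o 1) = o 1 ∧ f (o 2) = o 2 ∧ f (o 3) = o 3 ∧ f (o 4) = o 4 ∧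
      f (o 11) = o 11 ∧ f (o 7) = o 7 ∧ f (o 8) = o 8 ∧ f (o 9) = o 9 ∧ f (o 13) = o 13 ∧
      f (o 14) = o 14 := by
    simp [hf, pow_succ, hDt, hJt]
  obtain ⟨h1, h2, h3, h4, h11, h7, h8, h9, h13, h14⟩ := hcycle
  have hfE (x : A) : f (D (J x)) = D (J (f x)) :=
    DFunLike.congr_fun (Commute.pow_self (D * J) 5).eq x
  have h5 : f (o 5) = o 5 := by
    have h : c • f (o 5) = c • o 5 := by
      rw [← map_smul, hrel]; simp only [map_sub, map_add, map_mul, h1, h2, h3, h7, h8, h13]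
    simpa [smul_smul, inv_mul_cancel₀ hc] using congrArg (c⁻¹ • ·) h
  have h0 : f (o 0) = o 0 := by simpa [hDt, hJt, h5] using hfE (o 5)
  have h6 : f (o 6) = o 6 := by simpa [hDt, hJt, h0, h1] using hfE (o 0)
  have hinj {x : A} (h : f (D (J x)) = D (J x)) : f x = x := by
    rw [hfE] at h; exact J.injective (D.injective h)
  have h10 : f (o 10) = o 10 := hinj (by simp [hDt, hJt, h0, h11, h5])
  have h12 : f (o 12) = o 12 := hinj (by simp [hDt, hJt, h0, h13, h10])
  fin_cases i <;> assumption

end GeneratorActions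

theorem ct_ne_zero : ct ≠ 0 := by
  intro h
  have hX : (RatFunc.X : kt) ≠ 0 := RatFunc.X_ne_zero
  have h4 : (RatFunc.X : kt) ^ 4 + 1 = 0 := by
    have : (RatFunc.X : kt) ^ 4 + 1 = RatFunc.X ^ 2 * ct := by
      rw [ct]; field_simp
    rw [this, h, mul_zero]
  have hp : (Polynomial.X ^ 4 + 1 : Polynomial ℂ) = 0 := by
    apply RatFunc.algebraMap_injective ℂ
    simpa using h4
  simpa using congrArg (Polynomial.eval 0) hp

theorem ct_smul_mk_X_five :
    ct • Ideal.Quotient.mk (Idl kt ct) (X 5) =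
      Ideal.Quotient.mk (Idl kt ct) (X 1) * Ideal.Quotient.mk (Idl kt ct) (X 3)
      + Ideal.Quotient.mk (Idl kt ct) (X 2) * Ideal.Quotient.mk (Idl kt ct) (X 13)
      - Ideal.Quotient.mk (Idl kt ct) (X 7) * Ideal.Quotient.mk (Idl kt ct) (X 8) := by
  have hmem : relA kt ct 6 ∈ Idl kt ct :=
    Ideal.subset_span (Or.inl ⟨6, by norm_num, le_rfl, Or.inl rfl⟩)
  have h := Ideal.Quotient.eq_zero_iff_mem.2 hmem
  have hC : Ideal.Quotient.mk (Idl kt ct) (C ct * X 5)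
      = ct • Ideal.Quotient.mk (Idl kt ct) (X 5) := by
    rw [C_mul']; rfl
  have hrel : relA kt ct 6 = X 1 * X 3 + X 2 * X 13 - X 7 * X 8 - C ct * X 5 := rfl
  rw [hrel, map_sub, hC, sub_eq_zero] at h
  rw [← h]; simp only [map_sub, map_add, map_mul]

theorem Aq1t_algEquiv_ext {f g : Aq1t ≃ₐ[kt] Aq1t}
    (h : ∀ i, f (Ideal.Quotient.mk (Idl kt ct) (X i)) = g (Ideal.Quotient.mk (Idl kt ct) (X i))) :
    f = g := by
  have hfg : f.toAlgHom.comp (Ideal.Quotient.mkₐ kt (Idl kt ct))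
      = g.toAlgHom.comp (Ideal.Quotient.mkₐ kt (Idl kt ct)) := MvPolynomial.algHom_ext h
  ext x
  obtain ⟨p, rfl⟩ := Ideal.Quotient.mk_surjective x
  exact DFunLike.congr_fun hfg p

theorem mk_eq_aeval (p : MvPolynomial (Fin 15) kt) :
    Ideal.Quotient.mk (Idl kt ct) p
      = aeval (fun i => Ideal.Quotient.mk (Idl kt ct) (X i)) p :=
  DFunLike.congr_fun (aeval_unique (Ideal.Quotient.mkₐ kt (Idl kt ct))) p

/-- the automorphisms `D₁` (induced by the substitution `d₁`) and `𝕁` (induced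
by the cyclic permutation `𝕀`) of `𝒜_{q=1,t}` define an action of `Mod(Σ₂)`: there is a group
homomorphism `φ : Mod(Σ₂) → Aut(𝒜_{q=1,t})` with `φ(d_i) = 𝕁^{i-1} ∘ D₁ ∘ 𝕁^{1-i}`; moreover
`φ(d₁d₂d₃d₄d₅) = 𝕁` and `φ(H) = id`. -/
theorem MCG_action_on_Aq1t
    (D1 Jay : Aq1t ≃ₐ[kt] Aq1t)
    (hD : ∀ p : MvPolynomial (Fin 15) kt,
      D1 (Ideal.Quotient.mk (Idl kt ct) p) = Ideal.Quotient.mk (Idl kt ct) (d1hom p))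
    (hJ : ∀ p : MvPolynomial (Fin 15) kt,
      Jay (Ideal.Quotient.mk (Idl kt ct) p) = Ideal.Quotient.mk (Idl kt ct) (Iauto p)) :
    ∃ φ : MCG →* (Aq1t ≃ₐ[kt] Aq1t),
      (∀ i : Fin 5, ∀ x : Aq1t,
        φ (PresentedGroup.of (rels := mcgRels) i) x
          = (Jay ^ (i : ℕ)) (D1 ((Jay ^ (i : ℕ)).symm x))) ∧
      (∀ x : Aq1t,
        φ (PresentedGroup.of (rels := mcgRels) 0 * PresentedGroup.of 1 * PresentedGroup.of 2 *
            PresentedGroup.of 3 * PresentedGroup.of 4) x = Jay x) ∧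
      (∀ x : Aq1t,
        φ (PresentedGroup.of (rels := mcgRels) 0 * PresentedGroup.of 1 * PresentedGroup.of 2 *
            PresentedGroup.of 3 * PresentedGroup.of 4 * PresentedGroup.of 4 *
            PresentedGroup.of 3 * PresentedGroup.of 2 * PresentedGroup.of 1 *
            PresentedGroup.of 0) x = x) := by
  have hDo (i : Fin 15) : D1 (Ideal.Quotient.mk (Idl kt ct) (X i))
      = aeval (fun j => Ideal.Quotient.mk (Idl kt ct) (X j)) (d1imgs i) := by
    rw [hD, ← mk_eq_aeval, d1hom, aeval_X]
  have hJo (i : Fin 15) : Jay (Ideal.Quotient.mk (Idl kt ct) (X i))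
      = Ideal.Quotient.mk (Idl kt ct) (X (sigmaPerm i)) := by
    rw [hJ, Iauto, renameEquiv_apply, rename_X]
  obtain ⟨φ, hφ, hI, hH⟩ := exists_MCG_hom D1 Jay
    (Aq1t_algEquiv_ext (sigma_pow_six hJo))
    (Aq1t_algEquiv_ext (d1_braid hDo hJo))
    (Aq1t_algEquiv_ext (d1_comm_two hDo hJo))
    (Aq1t_algEquiv_ext (d1_comm_three hDo hJo))
    (Aq1t_algEquiv_ext (d1_mul_sigma_pow_five hDo hJo ct_ne_zero ct_smul_mk_X_five))
    (Aq1t_algEquiv_ext (sigma_inv_mul_d1_pow_five hDo hJo))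
  refine ⟨φ, fun i x => ?_, fun x => ?_, fun x => ?_⟩
  · rw [hφ]; rfl
  · rw [hI]
  · rw [hH]; rfl
end
end

section
/- For every quadruple (X₁,Y₁,X₂,Y₂) of matrices in SL(2,ℂ) satisfying X₁Y₁X₁⁻¹Y₁⁻¹X₂Y₂X₂⁻¹Y₂⁻¹ = 1, the substitution O_J ↦ o_J of the trace values into each of the 19 generating elements of the ideal I_{q=t=1} yields zero. Explicitly, each generator of I_{q=t=1}, viewed as a polynomial in the 15 variables, evaluates to 0 ∈ ℂ at the point (o₁,…,o₆,o₁₂,…,o₆₁,o₁₂₃,o₂₃₄,o₃₄₅). -/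
noncomputable section

open MvPolynomial

/- Variable indexing of the polynomial ring in 15 variables:
`0,…,5 ↦ O₁,…,O₆`, `6,…,11 ↦ O₁₂,O₂₃,O₃₄,O₄₅,O₅₆,O₆₁`, `12,13,14 ↦ O₁₂₃,O₂₃₄,O₃₄₅`. -/

variable (R : Type) [Field R]

/-- `SL(2,ℂ)`. -/
abbrev SL2 : Type := Matrix.SpecialLinearGroup (Fin 2) ℂ

/-- The trace of an element of `SL(2,ℂ)`. -/
def tr (M : SL2) : ℂ := Matrix.trace (M : Matrix (Fin 2) (Fin 2) ℂ)

/-- The genus-two surface relation `X₁Y₁X₁⁻¹Y₁⁻¹X₂Y₂X₂⁻¹Y₂⁻¹ = 1`. -/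
def SurfRel (X1 Y1 X2 Y2 : SL2) : Prop :=
  X1 * Y1 * X1⁻¹ * Y1⁻¹ * X2 * Y2 * X2⁻¹ * Y2⁻¹ = 1

/-- The 15 trace values `o₁,…,o₆,o₁₂,…,o₆₁,o₁₂₃,o₂₃₄,o₃₄₅` associated to a quadruple. -/
def assign (X1 Y1 X2 Y2 : SL2) : Fin 15 → ℂ :=
  ![tr Y1, tr X1, tr (Y1 * Y2), tr X2, tr Y2, tr (X1 * Y2 * X2⁻¹ * Y2⁻¹),
    tr (Y1 * X1⁻¹), tr (X1⁻¹ * Y1⁻¹ * Y2⁻¹), tr (Y2⁻¹ * Y1⁻¹ * X2), tr (Y2 * X2),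
    tr (X1 * Y2 ^ 2 * X2⁻¹ * Y2⁻¹), tr (X1 * Y1 * Y2 * X2⁻¹ * Y2⁻¹),
    tr (Y1 * X1⁻¹ * Y1⁻¹ * Y2⁻¹), tr (X1 * Y1 * Y2 ^ 2 * X2⁻¹ * Y2⁻¹), tr (X2 * Y1⁻¹)]

lemma tr_mul_comm (A B : SL2) : tr (A * B) = tr (B * A) := by
  simp only [tr, Matrix.SpecialLinearGroup.coe_mul]
  exact Matrix.trace_mul_comm _ _

lemma tr_inv (A : SL2) : tr A⁻¹ = tr A := by
  simp [tr, Matrix.SpecialLinearGroup.coe_inv, Matrix.adjugate_fin_two, Matrix.trace_fin_two,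
    add_comm]

lemma tr_conj (A B : SL2) : tr (A * B * A⁻¹) = tr B := by
  rw [tr_mul_comm, inv_mul_cancel_left]

lemma tr_mul_tr (A B : SL2) : tr A * tr B = tr (A * B) + tr (A * B⁻¹) := by
  simp only [tr, Matrix.SpecialLinearGroup.coe_mul, Matrix.SpecialLinearGroup.coe_inv,
    Matrix.adjugate_fin_two, Matrix.trace_fin_two, Matrix.mul_apply, Fin.sum_univ_two,
    Matrix.of_apply, Matrix.cons_val', Matrix.cons_val_zero, Matrix.cons_val_one,
    Matrix.cons_val_fin_one]
  ring

lemma tr_mul_mul_tr_mul (u v w : SL2) :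
    tr (u * v) * tr (v * w) =
      tr v * tr (u * v * w) - tr (u * w) + tr u * tr w - tr (u * v * w * v⁻¹) := by
  have h₁ := tr_mul_tr (u * v) (v * w)
  have h₂ := tr_mul_tr (w * u * v) v
  have h₃ := tr_mul_tr (v⁻¹ * u * v) w
  have h₄ := tr_mul_comm (u * v * v) w
  have h₅ := tr_mul_comm (u * v * w⁻¹) v⁻¹
  have h₆ := tr_mul_comm (u * v * w) v⁻¹
  have h₇ := tr_mul_comm w (u * v)
  have h₈ := tr_mul_comm w u
  have h₉ := tr_conj v⁻¹ u
  rw [mul_inv_cancel_right] at h₂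
  rw [inv_inv] at h₉
  rw [h₉] at h₃
  simp only [mul_inv_rev, mul_assoc] at *
  rw [h₇] at h₂
  linear_combination h₁ - h₂ - h₃ + h₄ + h₅ + h₆ - h₈

/-- The trace of a commutator (Fricke's identity). -/
lemma tr_commutator (a b : SL2) :
    tr (a * b * a⁻¹ * b⁻¹) = tr a ^ 2 + tr b ^ 2 + tr (a * b) ^ 2 - tr a * tr b * tr (a * b) - 2 := by
  have h₁ := tr_mul_mul_tr_mul a b a⁻¹
  have h₂ := tr_mul_tr b a
  rw [tr_conj, mul_inv_cancel, tr_inv] at h₁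
  rw [tr_mul_comm b a] at h₂
  have h₃ : tr 1 = 2 := by simp [tr]
  linear_combination h₁ - h₃ + tr (a * b) * h₂

lemma tr_mul_conj (a b : SL2) :
    tr (a * (b * a * b⁻¹)) =
      tr a * tr b * tr (a * b) - tr b ^ 2 - tr (a * b) ^ 2 + 2 := by
  have h₁ := tr_mul_tr a (b * a * b⁻¹)
  have h₂ := tr_commutator a b
  rw [tr_conj] at h₁
  simp only [mul_inv_rev, inv_inv, mul_assoc] at h₁ h₂ ⊢
  linear_combination -h₁ - h₂

/-- Six elements `c₁, …, c₆` satisfying the relations of the cyclically symmetric presentation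
`c₁c₃c₅ = c₂c₄c₆ = c₁c₂c₃c₄c₅c₆ = 1` of the genus-two surface group. -/
structure IsHexagon (a b c d e f : SL2) : Prop where
  odd : a * c * e = 1
  even : b * d * f = 1
  all : a * b * c * d * e * f = 1

namespace IsHexagon

variable {a b c d e f : SL2}

lemma rotate (h : IsHexagon a b c d e f) : IsHexagon b c d e f a where
  odd := h.even
  even := by
    have := h.odd
    rw [mul_assoc, mul_eq_one_iff_eq_inv'] at this
    rw [this, inv_mul_cancel]
  all := by
    have := h.all
    simp only [mul_assoc] at this ⊢
    rw [mul_eq_one_iff_eq_inv'] at this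
    simp only [← mul_assoc] at this ⊢
    rw [this, inv_mul_cancel]

lemma e_eq (h : IsHexagon a b c d e f) : e = (a * c)⁻¹ :=
  eq_inv_of_mul_eq_one_right h.odd

lemma f_eq (h : IsHexagon a b c d e f) : f = (b * d)⁻¹ :=
  eq_inv_of_mul_eq_one_right h.even

lemma mul_four (h : IsHexagon a b c d e f) : a * b * c * d = b * d * a * c := by
  have := h.all
  rw [h.e_eq, h.f_eq, mul_inv_eq_one, mul_inv_eq_iff_eq_mul] at this
  simpa only [mul_assoc] using this

lemma tr_mul_three (h : IsHexagon a b c d e f) : tr (d * e * f) = tr (a * b * c) := by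
  rw [← tr_inv (a * b * c), inv_eq_of_mul_eq_one_right (b := d * e * f)]
  simpa only [mul_assoc] using h.all

lemma tr_commutator_opposite (h : IsHexagon a b c d e f) :
    tr (a * b * a⁻¹ * b⁻¹) = tr (d * e * d⁻¹ * e⁻¹) := by
  have key : a * b * a⁻¹ * b⁻¹ = b * (d * e⁻¹ * d⁻¹ * e) * b⁻¹ := by
    calc a * b * a⁻¹ * b⁻¹ = a * b * c * d * (d⁻¹ * c⁻¹ * a⁻¹ * b⁻¹) := by group
      _ = _ := by rw [h.mul_four, h.e_eq]; group
  rw [key, tr_conj, ← tr_inv, ← tr_conj e]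
  congr 1
  group

/-- The sum of squares and triple product attached to two opposite one-holed tori agree. -/
lemma fricke_opposite (h : IsHexagon a b c d e f) :
    tr a ^ 2 + tr b ^ 2 + tr (a * b) ^ 2 - tr a * tr b * tr (a * b) =
      tr d ^ 2 + tr e ^ 2 + tr (d * e) ^ 2 - tr d * tr e * tr (d * e) := by
  have := h.tr_commutator_opposite
  rw [tr_commutator, tr_commutator] at this
  linear_combination this

lemma relation_pairs (h : IsHexagon a b c d e f) :
    tr c * tr e + tr d * tr (c * d * e) - tr (c * d) * tr (d * e) - 2 * tr a = 0 := by
  have h₁ : tr (c * e) = tr a := by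
    rw [← tr_inv a, inv_eq_of_mul_eq_one_right (b := c * e)]
    rw [← mul_assoc, h.odd]
  have h₂ : tr (c * d * e * d⁻¹) = tr a := by
    rw [← tr_conj b, ← tr_inv a]
    congr 1
    calc b * (c * d * e * d⁻¹) * b⁻¹ = a⁻¹ * (a * b * c * d * e * (b * d)⁻¹) := by group
      _ = a⁻¹ := by rw [← h.f_eq, h.all, mul_one]
  linear_combination -tr_mul_mul_tr_mul c d e + h₁ + h₂

lemma relation_pair_triple (h : IsHexagon a b c d e f) :
    -(tr d * tr (f * a)) - tr e * tr (b * c) + tr (d * e) * tr (b * c * d)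
      - 2 * (tr (a * b) - tr a * tr b) = 0 := by
  have h₁ : tr (b * c * d * e) = tr (f * a) := by
    rw [← tr_inv (f * a), inv_eq_of_mul_eq_one_left (b := f * a)]
    simpa only [mul_assoc] using h.rotate.all
  have hce : c * e = a⁻¹ := by
    rw [eq_inv_iff_mul_eq_one]; simpa only [mul_assoc] using h.rotate.rotate.odd
  have h₂ : tr (b * c * e) = tr (b * a⁻¹) := by rw [mul_assoc, hce]
  have h₃ : tr (b * c * d * e * d⁻¹) = tr (b * a⁻¹) := by
    rw [tr_mul_comm b a⁻¹]
    congr 1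
    calc b * c * d * e * d⁻¹ = a⁻¹ * (a * b * c * d * e * (b * d)⁻¹) * b := by group
      _ = a⁻¹ * b := by rw [← h.f_eq, h.all, mul_one]
  have h₄ := tr_mul_tr b a
  rw [tr_mul_comm b a] at h₄
  linear_combination tr_mul_mul_tr_mul (b * c) d e + tr d * h₁ - h₂ - h₃ + 2 * h₄

lemma tr_triple_mul_tr_triple (h : IsHexagon a b c d e f) :
    tr (a * b * c) * tr (b * c * d) =
      tr (b * c) * tr (e * f) + tr a * tr d - 2 * tr (a * d) := by
  have h₁ : tr (a * (b * c) * d) = tr (e * f) := by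
    rw [← tr_inv (a * (b * c) * d), inv_eq_of_mul_eq_one_right (b := e * f)]
    simpa only [mul_assoc] using h.all
  have h₂ : tr (a * (b * c) * d * (b * c)⁻¹) = tr (a * d) := by
    rw [tr_mul_comm a, ← tr_conj b (d * a)]
    congr 1
    calc a * (b * c) * d * (b * c)⁻¹ = a * b * c * d * (b * c)⁻¹ := by group
      _ = _ := by rw [h.mul_four]; group
  have := tr_mul_mul_tr_mul a (b * c) d
  rw [← mul_assoc a b c] at this h₁ h₂
  linear_combination this + tr (b * c) * h₁ - h₂

lemma relation_triples (h : IsHexagon a b c d e f) :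
    -(tr (b * c) * tr (e * f)) + tr (a * b * c) * tr (b * c * d) - tr a * tr d
      - 2 * (-tr (c * d * e) + tr b * tr (f * a) + tr f * tr (a * b) - tr a * tr b * tr f) = 0 := by
  have hT : tr (c * d * e) = tr (f * a * b) := h.rotate.rotate.tr_mul_three.symm
  have hd : b⁻¹ * f⁻¹ = d := by rw [h.f_eq]; group
  have h₁ := tr_mul_tr (f * a) b
  have h₂ := tr_mul_tr (a * b⁻¹) f
  have h₃ := tr_mul_tr a b
  rw [mul_assoc a b⁻¹ f⁻¹, hd, tr_mul_comm (a * b⁻¹) f, ← mul_assoc] at h₂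
  linear_combination h.tr_triple_mul_tr_triple + 2 * hT - 2 * h₁ + 2 * h₂ + 2 * tr f * h₃

lemma tr_mul_tr_triple (h : IsHexagon a b c d e f) :
    tr (a * d) * tr (c * d * e) =
      tr a * tr b * tr (a * b) - tr b ^ 2 - tr (a * b) ^ 2
        + (tr c * tr d * tr (c * d) - tr c ^ 2 - tr (c * d) ^ 2) + 4 := by
  have hT : tr (c * d * e) = tr (f * a * b) := h.rotate.rotate.tr_mul_three.symm
  have hinv : (f * a * b)⁻¹ = c * d * e := by
    rw [inv_eq_iff_mul_eq_one]
    simpa only [mul_assoc] using h.rotate.rotate.rotate.rotate.rotate.all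
  have h₁ : tr (a * d * (f * a * b)) = tr (a * (b * a * b⁻¹)) := by
    rw [← tr_conj b, tr_mul_comm a]
    congr 1
    rw [h.f_eq]; group
  have h₂ : tr (a * d * (f * a * b)⁻¹) = tr (d * (c * d * c⁻¹)) := by
    rw [hinv, ← tr_conj a (d * _)]
    congr 1
    rw [h.e_eq]; group
  have h₃ := tr_mul_conj d c
  rw [tr_mul_comm d c] at h₃
  rw [hT, tr_mul_tr, h₁, h₂, tr_mul_conj, h₃]
  ring

lemma relation_casimir (h : IsHexagon a b c d e f) :
    tr (a * b * c) * tr (b * c * d) * tr (c * d * e)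
      - (tr a * tr d * tr (c * d * e) + tr b * tr e * tr (a * b * c)
        + tr c * tr f * tr (b * c * d))
      + (tr a * tr f * tr (f * a) + tr b * tr a * tr (a * b) + tr c * tr b * tr (b * c)
        + tr d * tr c * tr (c * d) + tr e * tr d * tr (d * e) + tr f * tr e * tr (e * f))
      - (tr a * tr c * tr e + tr b * tr d * tr f)
      - (tr (a * b) ^ 2 + tr (b * c) ^ 2 + tr (c * d) ^ 2
        + tr (d * e) ^ 2 + tr (e * f) ^ 2 + tr (f * a) ^ 2) + 8 = 0 := by
  have hA₅ := h.rotate.rotate.rotate.rotate.relation_pairs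
  have hA₆ := h.rotate.rotate.rotate.rotate.rotate.relation_pairs
  linear_combination tr (c * d * e) * h.tr_triple_mul_tr_triple
    + tr (b * c) * h.rotate.relation_pair_triple - tr e * hA₅ - tr f * hA₆
    - 2 * h.tr_mul_tr_triple + h.fricke_opposite + h.rotate.fricke_opposite
    + h.rotate.rotate.fricke_opposite

end IsHexagon

/-- The cyclic shift `O_J ↦ O_{J+1}` of the 15 indices. -/
def rotateIndex : Fin 15 → Fin 15 := ![1, 2, 3, 4, 5, 0, 7, 8, 9, 10, 11, 6, 13, 14, 12]

lemma eval_vS_succ (o : Fin 15 → ℂ) (n : ℕ) (hn : 1 ≤ n) :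
    eval o (vS ℂ (n + 1)) = eval (o ∘ rotateIndex) (vS ℂ n) := by
  have key : ∀ m (hm : m < 6), rotateIndex ⟨m, by omega⟩ = ⟨(m + 1) % 6, by omega⟩ := by
    intro m hm
    interval_cases m <;> rfl
  have hmod : (n + 1 - 1) % 6 = ((n - 1) % 6 + 1) % 6 := by omega
  simp only [vS, eval_X, Function.comp_apply, hmod, key _ (Nat.mod_lt _ (by norm_num : 0 < 6))]

lemma eval_vP_succ (o : Fin 15 → ℂ) (n : ℕ) (hn : 1 ≤ n) :
    eval o (vP ℂ (n + 1)) = eval (o ∘ rotateIndex) (vP ℂ n) := by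
  have key : ∀ m (hm : m < 6), rotateIndex ⟨6 + m, by omega⟩ = ⟨6 + (m + 1) % 6, by omega⟩ := by
    intro m hm
    interval_cases m <;> rfl
  have hmod : (n + 1 - 1) % 6 = ((n - 1) % 6 + 1) % 6 := by omega
  simp only [vP, eval_X, Function.comp_apply, hmod, key _ (Nat.mod_lt _ (by norm_num : 0 < 6))]

lemma eval_vT_succ (o : Fin 15 → ℂ) (n : ℕ) (hn : 1 ≤ n) :
    eval o (vT ℂ (n + 1)) = eval (o ∘ rotateIndex) (vT ℂ n) := by
  have key : ∀ m (hm : m < 3), rotateIndex ⟨12 + m, by omega⟩ = ⟨12 + (m + 1) % 3, by omega⟩ := by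
    intro m hm
    interval_cases m <;> rfl
  have hmod : (n + 1 - 1) % 3 = ((n - 1) % 3 + 1) % 3 := by omega
  simp only [vT, eval_X, Function.comp_apply, hmod, key _ (Nat.mod_lt _ (by norm_num : 0 < 3))]

lemma eval_relA_succ (o : Fin 15 → ℂ) (k : ℂ) (i : ℕ) (hi : 1 ≤ i) :
    eval o (relA ℂ k (i + 1)) = eval (o ∘ rotateIndex) (relA ℂ k i) := by
  simp [relA, Nat.add_right_comm i 1, eval_vS_succ, eval_vP_succ, eval_vT_succ, hi]

lemma eval_relB_succ (o : Fin 15 → ℂ) (k : ℂ) (i : ℕ) (hi : 1 ≤ i) :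
    eval o (relB ℂ k (i + 1)) = eval (o ∘ rotateIndex) (relB ℂ k i) := by
  simp [relB, Nat.add_right_comm i 1, eval_vS_succ, eval_vP_succ, eval_vT_succ, hi]

lemma eval_relC_succ (o : Fin 15 → ℂ) (k : ℂ) (i : ℕ) (hi : 1 ≤ i) :
    eval o (relC ℂ k (i + 1)) = eval (o ∘ rotateIndex) (relC ℂ k i) := by
  simp [relC, Nat.add_right_comm i 1, eval_vS_succ, eval_vP_succ, eval_vT_succ, hi]

/-- The 15 traces attached to a hexagon of elements of `SL(2,ℂ)`. -/
def hexagonTraces (a b c d e f : SL2) : Fin 15 → ℂ :=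
  ![tr a, tr b, tr c, tr d, tr e, tr f,
    tr (a * b), tr (b * c), tr (c * d), tr (d * e), tr (e * f), tr (f * a),
    tr (a * b * c), tr (b * c * d), tr (c * d * e)]

namespace IsHexagon

variable {a b c d e f : SL2}

lemma hexagonTraces_comp_rotateIndex (h : IsHexagon a b c d e f) :
    hexagonTraces a b c d e f ∘ rotateIndex = hexagonTraces b c d e f a := by
  have hT := h.tr_mul_three
  funext j
  fin_cases j <;> first | rfl | exact hT.symm

lemma eval_relA (h : IsHexagon a b c d e f) (i : ℕ) (hi : 1 ≤ i) :
    eval (hexagonTraces a b c d e f) (relA ℂ 2 i) = 0 := by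
  induction i, hi using Nat.le_induction generalizing a b c d e f with
  | base => simpa [relA, vS, vP, vT, hexagonTraces] using h.relation_pairs
  | succ i hi ih => rw [eval_relA_succ _ _ _ hi, h.hexagonTraces_comp_rotateIndex, ih h.rotate]

lemma eval_relB (h : IsHexagon a b c d e f) (i : ℕ) (hi : 1 ≤ i) :
    eval (hexagonTraces a b c d e f) (relB ℂ 2 i) = 0 := by
  induction i, hi using Nat.le_induction generalizing a b c d e f with
  | base => simpa [relB, vS, vP, vT, hexagonTraces] using h.relation_pair_triple
  | succ i hi ih => rw [eval_relB_succ _ _ _ hi, h.hexagonTraces_comp_rotateIndex, ih h.rotate]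

lemma eval_relC (h : IsHexagon a b c d e f) (i : ℕ) (hi : 1 ≤ i) :
    eval (hexagonTraces a b c d e f) (relC ℂ 2 i) = 0 := by
  induction i, hi using Nat.le_induction generalizing a b c d e f with
  | base => simpa [relC, vS, vP, vT, hexagonTraces] using h.relation_triples
  | succ i hi ih => rw [eval_relC_succ _ _ _ hi, h.hexagonTraces_comp_rotateIndex, ih h.rotate]

lemma eval_casimirRel (h : IsHexagon a b c d e f) :
    eval (hexagonTraces a b c d e f) (casimirRel ℂ 2) = 0 := by
  have := h.relation_casimir
  simp [casimirRel, vS, vP, vT, hexagonTraces]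
  linear_combination this

end IsHexagon

/-- A solution of the surface relation gives a hexagon. -/
lemma SurfRel.isHexagon {X1 Y1 X2 Y2 : SL2} (h : SurfRel X1 Y1 X2 Y2) :
    IsHexagon Y1 X1⁻¹ (Y1⁻¹ * Y2⁻¹) (Y2 * X2 * Y2⁻¹) Y2 (Y2 * X2⁻¹ * Y2⁻¹ * X1) where
  odd := by group
  even := by group
  all := by
    calc _ = X1⁻¹ * (X1 * Y1 * X1⁻¹ * Y1⁻¹ * X2 * Y2 * X2⁻¹ * Y2⁻¹) * X1 := by group
      _ = 1 := by rw [h]; group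

lemma assign_eq_hexagonTraces {X1 Y1 X2 Y2 : SL2} (h : SurfRel X1 Y1 X2 Y2) :
    assign X1 Y1 X2 Y2 =
      hexagonTraces Y1 X1⁻¹ (Y1⁻¹ * Y2⁻¹) (Y2 * X2 * Y2⁻¹) Y2 (Y2 * X2⁻¹ * Y2⁻¹ * X1) := by
  have h₃ : tr (Y1 * Y2) = tr (Y1⁻¹ * Y2⁻¹) := by
    rw [← tr_inv (Y1⁻¹ * Y2⁻¹), tr_mul_comm]
    congr 1
    group
  have h₆ : tr (X1 * Y2 * X2⁻¹ * Y2⁻¹) = tr (Y2 * X2⁻¹ * Y2⁻¹ * X1) := by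
    rw [tr_mul_comm _ X1]
    simp only [mul_assoc]
  have h₃₄ : tr (Y2⁻¹ * Y1⁻¹ * X2) = tr (Y1⁻¹ * Y2⁻¹ * (Y2 * X2 * Y2⁻¹)) := by
    rw [mul_assoc, tr_mul_comm]
    congr 1
    group
  have h₄₅ : tr (Y2 * X2) = tr (Y2 * X2 * Y2⁻¹ * Y2) := by rw [inv_mul_cancel_right]
  have h₅₆ : tr (X1 * Y2 ^ 2 * X2⁻¹ * Y2⁻¹) = tr (Y2 * (Y2 * X2⁻¹ * Y2⁻¹ * X1)) := by
    rw [← mul_assoc, tr_mul_comm _ X1]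
    simp only [sq, mul_assoc]
  have h₆₁ : tr (X1 * Y1 * Y2 * X2⁻¹ * Y2⁻¹) = tr (Y2 * X2⁻¹ * Y2⁻¹ * X1 * Y1) := by
    rw [mul_assoc _ X1, tr_mul_comm _ (X1 * Y1)]
    simp only [mul_assoc]
  have h₂₃₄ : tr (X1 * Y1 * Y2 ^ 2 * X2⁻¹ * Y2⁻¹) =
      tr (X1⁻¹ * (Y1⁻¹ * Y2⁻¹) * (Y2 * X2 * Y2⁻¹)) := by
    rw [← h.isHexagon.rotate.tr_mul_three, ← mul_assoc Y2, mul_assoc _ X1 Y1,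
      tr_mul_comm _ (X1 * Y1)]
    simp only [sq, mul_assoc]
  have h₃₄₅ : tr (X2 * Y1⁻¹) = tr (Y1⁻¹ * Y2⁻¹ * (Y2 * X2 * Y2⁻¹) * Y2) := by
    rw [tr_mul_comm]
    congr 1
    group
  rw [assign, hexagonTraces, tr_inv, tr_conj, h₃, h₆, h₃₄, h₄₅, h₅₆, h₆₁, h₂₃₄, h₃₄₅,
    mul_assoc X1⁻¹ Y1⁻¹ Y2⁻¹, mul_assoc (Y1 * X1⁻¹) Y1⁻¹ Y2⁻¹]

/-- for every quadruple in `SL(2,ℂ)` satisfying the genus-two surface relation,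
each of the 19 generators of `I_{q=t=1}` evaluates to `0` at the point of trace values. -/
theorem gens_vanish_on_traces (X1 Y1 X2 Y2 : SL2) (h : SurfRel X1 Y1 X2 Y2) :
    ∀ p ∈ gens ℂ 2, MvPolynomial.eval (assign X1 Y1 X2 Y2) p = 0 := by
  rw [assign_eq_hexagonTraces h]
  rintro p (⟨i, hi, -, rfl | rfl | rfl⟩ | rfl)
  · exact h.isHexagon.eval_relA i hi
  · exact h.isHexagon.eval_relB i hi
  · exact h.isHexagon.eval_relC i hi
  · exact h.isHexagon.eval_casimirRel
end
end

section
/- For every quadruple (X₁,Y₁,X₂,Y₂) of matrices in SL(2,ℂ) satisfying X₁Y₁X₁⁻¹Y₁⁻¹X₂Y₂X₂⁻¹Y₂⁻¹ = 1, the following trace identity holds: tr(X₁Y₁Y₂X₂⁻¹Y₂⁻¹) = −tr(Y₁X₂)·tr(X₁)·tr(Y₂)² + tr(X₁)·tr(X₂)·tr(Y₁)·tr(Y₂)² + tr(Y₂)·tr(X₁Y₂)·tr(Y₁X₂) − tr(X₁X₂)·tr(Y₁Y₂)·tr(Y₂) + tr(X₁)·tr(Y₂)·tr(Y₁X₂Y₂)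 − tr(X₁)·tr(Y₁)·tr(Y₂)·tr(X₂Y₂) − tr(X₂)·tr(Y₁)·tr(Y₂)·tr(X₁Y₂) + tr(Y₁Y₂)·tr(X₁X₂Y₂) − tr(X₁Y₁X₂) − tr(X₁Y₂)·tr(Y₁X₂Y₂) + tr(X₁)·tr(Y₁X₂) + tr(X₂)·tr(X₁Y₁) + tr(X₁X₂)·tr(Y₁) + tr(Y₁)·tr(X₁Y₂)·tr(X₂Y₂) − tr(X₁)·tr(X₂)·tr(Y₁). -/
noncomputable section

/-- a trace identity for `tr(X₁Y₁Y₂X₂⁻¹Y₂⁻¹)` on the genus-two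
representation variety. -/
theorem trace_identity_15 (X1 Y1 X2 Y2 : SL2) (h : SurfRel X1 Y1 X2 Y2) :
    tr (X1 * Y1 * Y2 * X2⁻¹ * Y2⁻¹)
      = -(tr (Y1 * X2) * tr X1 * tr Y2 ^ 2) + tr X1 * tr X2 * tr Y1 * tr Y2 ^ 2
        + tr Y2 * tr (X1 * Y2) * tr (Y1 * X2) - tr (X1 * X2) * tr (Y1 * Y2) * tr Y2
        + tr X1 * tr Y2 * tr (Y1 * X2 * Y2) - tr X1 * tr Y1 * tr Y2 * tr (X2 * Y2)
        - tr X2 * tr Y1 * tr Y2 * tr (X1 * Y2) + tr (Y1 * Y2) * tr (X1 * X2 * Y2)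
        - tr (X1 * Y1 * X2) - tr (X1 * Y2) * tr (Y1 * X2 * Y2)
        + tr X1 * tr (Y1 * X2) + tr X2 * tr (X1 * Y1) + tr (X1 * X2) * tr Y1
        + tr Y1 * tr (X1 * Y2) * tr (X2 * Y2) - tr X1 * tr X2 * tr Y1 := by
  have hdet : (Y2 : Matrix (Fin 2) (Fin 2) ℂ) 0 0 * (Y2 : Matrix (Fin 2) (Fin 2) ℂ) 1 1
      - (Y2 : Matrix (Fin 2) (Fin 2) ℂ) 0 1 * (Y2 : Matrix (Fin 2) (Fin 2) ℂ) 1 0 = 1 := by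
    rw [← Matrix.det_fin_two]; exact Y2.det_coe
  -- Homogeneous in every matrix after weighting the degree-zero terms in `Y2` by `det Y2`.
  simp only [tr, Matrix.SpecialLinearGroup.coe_mul, Matrix.SpecialLinearGroup.coe_inv]
  generalize (X1 : Matrix (Fin 2) (Fin 2) ℂ) = A, (Y1 : Matrix (Fin 2) (Fin 2) ℂ) = B,
    (X2 : Matrix (Fin 2) (Fin 2) ℂ) = C, (Y2 : Matrix (Fin 2) (Fin 2) ℂ) = D at hdet ⊢
  linear_combination (norm := skip)
    (-(A * B * C).trace + A.trace * (B * C).trace + C.trace * (A * B).trace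
    + (A * C).trace * B.trace - A.trace * C.trace * B.trace) * hdet
  simp only [Matrix.adjugate_fin_two, Matrix.trace_fin_two, Matrix.mul_apply, Fin.sum_univ_two,
    Matrix.of_apply, Matrix.cons_val', Matrix.cons_val_zero, Matrix.cons_val_one,
    Matrix.cons_val_fin_one]
  ring
end
end
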